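/- arXiv:2411.16663 — 2 statements merged into one kernel-verified Lean document; each statement's English description precedes it below -/
import Mathlib

section
/- Let u : ℝ² → ℂ (with coordinates (t,x)) be C^∞ on ℝ² and satisfy the one-dimensional heat equation ∂u/∂t = ∂²u/∂x² at every point (t,x) with x ≥ 0, together with the Neumann boundary condition (∂u/∂x)(t,0) = 0 for all t ∈ ℝ. For ζ ∈ ℂ define b_ζ : ℝ² → ℂ by b_ζ(t,x) = exp(ζ² t + ζ x) + exp(ζ² t − ζ x). Then for every compact set K ⊆ ℝ × [0,∞), every m ∈ ℕ, and every ε > 0, there exist r ∈ ℕ, ζ_1, …, ζ_r ∈ ℂ, and c_1, …, c_r ∈ ℂ such that for every k ≤ m, the k-th iterated derivative of u − Σ_{j=1}^r c_j b_{ζ_j} has norm at most ε at every point of K. -/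
/-- Partial derivative in the first (time) variable. -/
noncomputable def dT (u : ℝ × ℝ → ℂ) : ℝ × ℝ → ℂ :=
  fun p => deriv (fun s => u (s, p.2)) p.1

/-- Partial derivative in the second (space) variable. -/
noncomputable def dX (u : ℝ × ℝ → ℂ) : ℝ × ℝ → ℂ :=
  fun p => deriv (fun s => u (p.1, s)) p.2

/-- B-EPGP basis element for the 1D heat equation with Neumann boundary condition. -/
noncomputable def heatNeumannBasis (ζ : ℂ) : ℝ × ℝ → ℂ :=
  fun p => Complex.exp (ζ ^ 2 * (p.1 : ℂ) + ζ * (p.2 : ℂ)) +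
    Complex.exp (ζ ^ 2 * (p.1 : ℂ) - ζ * (p.2 : ℂ))

open MeasureTheory Filter Topology

theorem hasSum_iteratedFDeriv_of_isOpen {ι E F : Type*} [NormedAddCommGroup E] [NormedSpace ℝ E]
    [NormedAddCommGroup F] [NormedSpace ℝ F] [CompleteSpace F] {s : Set E} (hs : IsOpen s)
    {g : ι → E → F} (hg : ∀ i, ContDiff ℝ (⊤ : ℕ∞) (g i)) {v : ℕ → ι → ℝ}
    (hv : ∀ k, Summable (v k))
    (hb : ∀ k i, ∀ x ∈ s, ‖iteratedFDeriv ℝ k (g i) x‖ ≤ v k i) {f : E → F}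
    (hf : ∀ x ∈ s, HasSum (fun i => g i x) (f x)) (k : ℕ) :
    ∀ x ∈ s, HasSum (fun i => iteratedFDeriv ℝ k (g i) x) (iteratedFDeriv ℝ k f x) := by
  induction k with
  | zero =>
    intro x hx
    have := (continuousMultilinearCurryFin0 ℝ E F).symm.toContinuousLinearEquiv.hasSum'.mpr (hf x hx)
    exact this
  | succ k ih =>
    intro x hx
    have hd : ∀ i, Differentiable ℝ (iteratedFDeriv ℝ k (g i)) := fun i =>
      (hg i).differentiable_iteratedFDeriv (by exact_mod_cast ENat.natCast_lt_top k)
    have hb' : ∀ i, ∀ y ∈ s, ‖fderiv ℝ (iteratedFDeriv ℝ k (g i)) y‖ ≤ v (k + 1) i := by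
      intro i y hy
      rw [norm_fderiv_iteratedFDeriv]
      exact hb _ i y hy
    have key := hasFDerivAt_of_tendstoUniformlyOn hs (tendstoUniformlyOn_tsum (hv (k+1)) hb')
      (fun t y _ => HasFDerivAt.fun_sum fun n _ => (hd n y).hasFDerivAt)
      (fun y hy => ih y hy) hx
    have hsum : HasSum (fun i => fderiv ℝ (iteratedFDeriv ℝ k (g i)) x)
        (fderiv ℝ (iteratedFDeriv ℝ k f) x) := by
      rw [key.fderiv]
      exact (Summable.of_norm_bounded (hv (k+1)) (fun i => hb' i x hx)).hasSum
    simp only [iteratedFDeriv_succ_eq_comp_left, Function.comp_apply]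
    exact (continuousMultilinearCurryLeftEquiv ℝ (fun _ : Fin (k+1) => E) F).symm
      |>.toContinuousLinearEquiv.hasSum'.mpr hsum

theorem norm_iteratedFDeriv_cexp_smul_le {E : Type} [NormedAddCommGroup E] [NormedSpace ℝ E]
    (L : E →L[ℝ] ℂ) (k : ℕ) : ∀ {F : Type} [NormedAddCommGroup F] [NormedSpace ℂ F]
    (v : F) (x : E), ‖iteratedFDeriv ℝ k (fun y => Complex.exp (L y) • v) x‖ ≤
      ‖Complex.exp (L x)‖ * ‖L‖ ^ k * ‖v‖ := by
  induction k with
  | zero => intro F _ _ v x; simp [norm_smul]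
  | succ k ih =>
    intro F _ _ v x
    rw [← norm_iteratedFDeriv_fderiv]
    have : fderiv ℝ (fun y => Complex.exp (L y) • v) = fun y => Complex.exp (L y) • L.smulRight v := by
      ext1 y
      have h := (L.hasFDerivAt (x := y)).cexp.smul_const v
      rw [h.fderiv]
      ext z
      simp [mul_smul]
    rw [this]
    refine (ih _ x).trans ?_
    rw [pow_succ, mul_assoc, mul_assoc, mul_assoc]
    gcongr
    refine ContinuousLinearMap.opNorm_le_bound _ (by positivity) fun z => ?_
    rw [ContinuousLinearMap.smulRight_apply, norm_smul, mul_right_comm]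
    gcongr
    exact L.le_opNorm z

/-- The Fourier coefficients of a function on `[-a, a]`. -/
noncomputable def symmFourierCoeff (a : ℝ) (f : ℝ → ℂ) (n : ℤ) : ℂ :=
  (1 / (2 * a) : ℝ) * ∫ t in -a..a, Complex.exp (-((Real.pi * n / a * t : ℝ) * Complex.I)) * f t

theorem fourierCoeffOn_eq_symmFourierCoeff {a : ℝ} (ha : 0 < a) (h : -a < a) (f : ℝ → ℂ) (n : ℤ) :
    fourierCoeffOn h f n = symmFourierCoeff a f n := by
  rw [fourierCoeffOn_eq_integral, symmFourierCoeff, Complex.real_smul,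
    show a - -a = 2 * a by ring]
  congr 1
  refine intervalIntegral.integral_congr fun t _ => ?_
  simp only [fourier_coe_apply, smul_eq_mul]
  congr 2
  push_cast
  have : (a : ℂ) ≠ 0 := by exact_mod_cast ha.ne'
  field_simp

theorem hasSum_symmFourierCoeff {a : ℝ} (ha : 0 < a) {f : ℝ → ℂ}
    (hf : ContinuousOn f (Set.Icc (-a) a)) (hper : f (-a) = f a)
    (hs : Summable (symmFourierCoeff a f)) {t : ℝ} (ht : t ∈ Set.Icc (-a) a) :
    HasSum (fun n : ℤ => symmFourierCoeff a f n *
      Complex.exp ((Real.pi * n / a * t : ℝ) * Complex.I)) (f t) := by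
  have : Fact (0 < 2 * a) := ⟨by linarith⟩
  have haa : -a < a := by linarith
  have hea : -a + 2 * a = a := by ring
  have hcont : Continuous (AddCircle.liftIoc (2 * a) (-a) f) :=
    AddCircle.liftIoc_continuous (by rw [hea, hper]) (by rwa [hea])
  have hcoeff : ∀ n, fourierCoeff (AddCircle.liftIoc (2 * a) (-a) f) n = symmFourierCoeff a f n := by
    intro n
    rw [fourierCoeff_liftIoc_eq, ← fourierCoeffOn_eq_symmFourierCoeff ha haa]
    congr
  have key : ∀ t ∈ Set.Ioc (-a) a, HasSum (fun n : ℤ => symmFourierCoeff a f n *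
      Complex.exp ((Real.pi * n / a * t : ℝ) * Complex.I)) (f t) := by
    intro t ht
    have := has_pointwise_sum_fourier_series_of_summable
      (f := ⟨AddCircle.liftIoc (2 * a) (-a) f, hcont⟩)
      (by convert hs using 1; ext n; exact hcoeff n) (t : AddCircle (2 * a))
    convert this using 1
    · ext n
      rw [smul_eq_mul, fourier_coe_apply]
      congr 1
      · exact (hcoeff n).symm
      · congr 1
        push_cast
        have : (a : ℂ) ≠ 0 := by exact_mod_cast ha.ne'
        field_simp
    · exact (AddCircle.liftIoc_coe_apply (by rwa [hea])).symm
  rcases eq_or_lt_of_le ht.1 with h | h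
  · subst h
    rw [hper]
    convert key a ⟨haa, le_rfl⟩ using 3 with n
    rw [Complex.exp_eq_exp_iff_exists_int]
    refine ⟨-n, ?_⟩
    have : (a : ℂ) ≠ 0 := by exact_mod_cast ha.ne'
    push_cast
    field_simp
    ring
  · exact key t ⟨h, ht.2⟩

theorem norm_symmFourierCoeff_le {a : ℝ} (ha : 0 < a) {f : ℝ → ℂ} {C : ℝ}
    (hC : ∀ t ∈ Set.Icc (-a) a, ‖f t‖ ≤ C) (n : ℤ) : ‖symmFourierCoeff a f n‖ ≤ C := by
  have h := intervalIntegral.norm_integral_le_of_norm_le_const (a := -a) (b := a) (C := C)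
    (f := fun t : ℝ => Complex.exp (-((Real.pi * n / a * t : ℝ) * Complex.I)) * f t) (by
      intro t ht
      rw [Set.uIoc_of_le (by linarith)] at ht
      rw [norm_mul, ← neg_mul, ← Complex.ofReal_neg, Complex.norm_exp_ofReal_mul_I, one_mul]
      exact hC t ⟨ht.1.le, ht.2⟩)
  rw [symmFourierCoeff, norm_mul, Complex.norm_real, Real.norm_of_nonneg (by positivity)]
  calc _ ≤ 1 / (2 * a) * (C * |a - -a|) := by gcongr
    _ = C := by
      rw [show a - -a = 2 * a by ring, abs_of_pos (by linarith)]
      field_simp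

theorem exists_symmFourierCoeff_decay {a : ℝ} (ha : 0 < a) (p : ℕ) : ∀ {f : ℝ → ℂ},
    ContDiff ℝ (⊤ : ℕ∞) f → tsupport f ⊆ Set.Ioo (-a) a →
    ∃ C, ∀ n : ℤ, ‖symmFourierCoeff a f n‖ * (1 + |(n : ℝ)|) ^ p ≤ C := by
  induction p with
  | zero =>
    intro f hf _
    obtain ⟨C, hC⟩ := isCompact_Icc.exists_bound_of_continuousOn
      (s := Set.Icc (-a) a) hf.continuous.continuousOn
    exact ⟨C, fun n => by simpa using norm_symmFourierCoeff_le ha hC n⟩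
  | succ p ih =>
    intro f hf hsupp
    obtain ⟨C, hC⟩ := ih (f := deriv f) (hf.iterate_deriv 1)
      ((tsupport_deriv_subset).trans hsupp)
    refine ⟨max ‖symmFourierCoeff a f 0‖ (2 * a / Real.pi * C), fun n => ?_⟩
    by_cases hn : n = 0
    · subst hn; simp
    refine le_max_of_le_right ?_
    have haa : -a < a := by linarith
    have hz : ∀ t, t ∉ Set.Ioo (-a) a → f t = 0 := fun t ht =>
      image_eq_zero_of_notMem_tsupport fun h => ht (hsupp h)
    have hdiff : Differentiable ℝ f := hf.differentiable (by simp)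
    have hcd : Continuous (deriv f) := (hf.iterate_deriv 1).continuous
    have h := fourierCoeffOn_of_hasDerivAt haa hn (fun x _ => (hdiff x).hasDerivAt)
      (hcd.intervalIntegrable _ _)
    rw [hz a (by simp), hz (-a) (by simp), fourierCoeffOn_eq_symmFourierCoeff ha,
      fourierCoeffOn_eq_symmFourierCoeff ha] at h
    have hn1 : (1 : ℝ) ≤ |(n : ℝ)| := by
      have := Int.one_le_abs hn
      exact_mod_cast this
    have h2 : ‖symmFourierCoeff a f n‖ = a / (Real.pi * |(n:ℝ)|) * ‖symmFourierCoeff a (deriv f) n‖ := by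
      rw [h]
      have : ((a : ℂ) - ((-a : ℝ) : ℂ)) = ((2 * a : ℝ) : ℂ) := by push_cast; ring
      rw [this]
      simp only [sub_self, mul_zero, zero_sub, norm_mul, norm_neg, norm_div, Complex.norm_real,
        Complex.norm_I, norm_one, Complex.norm_intCast, Real.norm_of_nonneg Real.pi_pos.le,
        Real.norm_of_nonneg (show (0 : ℝ) ≤ 2 * a by linarith)]
      have : ‖(2:ℂ)‖ = 2 := by simp
      rw [this]
      have := Real.pi_pos
      field_simp
    rw [h2, pow_succ]
    have hC' := hC n
    have hpi := Real.pi_pos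
    calc a / (Real.pi * |(n:ℝ)|) * ‖symmFourierCoeff a (deriv f) n‖ *
          ((1 + |(n:ℝ)|) ^ p * (1 + |(n:ℝ)|))
        = (a / (Real.pi * |(n:ℝ)|) * (1 + |(n:ℝ)|)) *
          (‖symmFourierCoeff a (deriv f) n‖ * (1 + |(n:ℝ)|) ^ p) := by ring
      _ ≤ 2 * a / Real.pi * C := by
        gcongr
        rw [div_mul_eq_mul_div, div_le_div_iff₀ (by positivity) hpi]
        have : 0 < a * Real.pi := by positivity
        nlinarith

theorem hasSum_cosine_series {R : ℝ} (hR : 0 < R) {w : ℝ → ℂ}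
    (hw : ContinuousOn w (Set.Icc 0 R)) {α : ℤ → ℂ}
    (hα : ∀ n : ℤ, α n = (1 / R : ℝ) * ∫ x in (0 : ℝ)..R, (Real.cos (Real.pi * n / R * x) : ℂ) * w x)
    (hs : Summable α) {x : ℝ} (hx : x ∈ Set.Icc 0 R) :
    HasSum (fun n : ℤ => α n * (Real.cos (Real.pi * n / R * x) : ℂ)) (w x) := by
  have hcont : ContinuousOn (fun x => w |x|) (Set.Icc (-R) R) := by
    refine hw.comp continuous_abs.continuousOn fun y hy => ⟨abs_nonneg y, abs_le.mpr hy⟩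
  have hc : ∀ n, symmFourierCoeff R (fun x => w |x|) n = α n := by
    intro n
    rw [hα, symmFourierCoeff]
    have hci : ContinuousOn (fun t : ℝ =>
        Complex.exp (-((Real.pi * n / R * t : ℝ) * Complex.I)) * w |t|) (Set.Icc (-R) R) :=
      ContinuousOn.mul (by fun_prop) hcont
    have hi1 : IntervalIntegrable (fun t : ℝ =>
        Complex.exp (-((Real.pi * n / R * t : ℝ) * Complex.I)) * w |t|) volume (-R) 0 :=
      (hci.mono (Set.Icc_subset_Icc_right hR.le)).intervalIntegrable_of_Icc (by linarith)
    have hi2 : IntervalIntegrable (fun t : ℝ =>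
        Complex.exp (-((Real.pi * n / R * t : ℝ) * Complex.I)) * w |t|) volume 0 R :=
      (hci.mono (Set.Icc_subset_Icc_left (by linarith))).intervalIntegrable_of_Icc hR.le
    rw [← intervalIntegral.integral_add_adjacent_intervals hi1 hi2]
    have hneg := intervalIntegral.integral_comp_neg (a := 0) (b := R) (fun t : ℝ =>
        Complex.exp (-((Real.pi * n / R * t : ℝ) * Complex.I)) * w |t|)
    rw [neg_zero] at hneg
    have hi1' : IntervalIntegrable (fun t : ℝ =>
        Complex.exp (-((Real.pi * n / R * -t : ℝ) * Complex.I)) * w |-t|) volume 0 R := by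
      refine ContinuousOn.intervalIntegrable_of_Icc hR.le ?_
      exact hci.comp (f := fun t : ℝ => -t) continuous_neg.continuousOn
        fun y hy => ⟨by linarith [hy.2], by linarith [hy.1]⟩
    rw [← hneg, ← intervalIntegral.integral_add hi1' hi2]
    have : ∫ x in (0:ℝ)..R, (Complex.exp (-((Real.pi * n / R * -x : ℝ) * Complex.I)) * w |-x| +
        Complex.exp (-((Real.pi * n / R * x : ℝ) * Complex.I)) * w |x|) =
        ∫ x in (0:ℝ)..R, 2 * ((Real.cos (Real.pi * n / R * x) : ℂ) * w x) := by
      refine intervalIntegral.integral_congr fun t ht => ?_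
      rw [Set.uIcc_of_le hR.le] at ht
      simp only [abs_neg, abs_of_nonneg ht.1]
      rw [Complex.ofReal_cos, ← mul_assoc, Complex.two_cos, mul_neg, Complex.ofReal_neg]
      ring_nf
    rw [this, intervalIntegral.integral_const_mul]
    push_cast
    have : (R : ℂ) ≠ 0 := by exact_mod_cast hR.ne'
    field_simp
  have hs' : Summable (symmFourierCoeff R (fun x => w |x|)) := by
    convert hs using 1; ext n; exact hc n
  have h1 := hasSum_symmFourierCoeff hR hcont (by simp) hs' (t := x) ⟨by linarith [hx.1], hx.2⟩
  have h2 := hasSum_symmFourierCoeff hR hcont (by simp) hs' (t := -x)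
    ⟨by linarith [hx.2], by linarith [hx.1]⟩
  have h3 := (h1.add h2).mul_left (1/2 : ℂ)
  have e : (1 / 2 : ℂ) * (w |x| + w |-x|) = w x := by
    rw [abs_neg, abs_of_nonneg hx.1]
    ring
  rw [e] at h3
  convert! h3 using 2 with n
  rw [hc, Complex.ofReal_cos, Complex.cos, mul_neg, Complex.ofReal_neg]
  ring

theorem hasDerivAt_dT {u : ℝ × ℝ → ℂ} (hu : Differentiable ℝ u) (t x : ℝ) :
    HasDerivAt (fun s => u (s, x)) (dT u (t, x)) t := by
  have : DifferentiableAt ℝ (fun s => u (s, x)) t := by fun_prop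
  exact this.hasDerivAt

theorem hasDerivAt_dX {u : ℝ × ℝ → ℂ} (hu : Differentiable ℝ u) (t x : ℝ) :
    HasDerivAt (fun s => u (t, s)) (dX u (t, x)) x := by
  have : DifferentiableAt ℝ (fun s => u (t, s)) x := by fun_prop
  exact this.hasDerivAt

theorem dT_eq_fderiv {u : ℝ × ℝ → ℂ} (hu : Differentiable ℝ u) :
    dT u = fun p => fderiv ℝ u p (1, 0) := by
  ext ⟨t, x⟩
  have h := (hu (t, x)).hasFDerivAt.comp_hasDerivAt t ((hasDerivAt_id t).prodMk (hasDerivAt_const t x))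
  exact h.deriv

theorem dX_eq_fderiv {u : ℝ × ℝ → ℂ} (hu : Differentiable ℝ u) :
    dX u = fun p => fderiv ℝ u p (0, 1) := by
  ext ⟨t, x⟩
  have h := (hu (t, x)).hasFDerivAt.comp_hasDerivAt x ((hasDerivAt_const x t).prodMk (hasDerivAt_id x))
  exact h.deriv

theorem contDiff_dT {u : ℝ × ℝ → ℂ} (hu : ContDiff ℝ (⊤ : ℕ∞) u) :
    ContDiff ℝ (⊤ : ℕ∞) (dT u) := by
  rw [dT_eq_fderiv (hu.differentiable (by simp))]
  exact (hu.fderiv_right (by simp)).clm_apply contDiff_const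

theorem contDiff_dX {u : ℝ × ℝ → ℂ} (hu : ContDiff ℝ (⊤ : ℕ∞) u) :
    ContDiff ℝ (⊤ : ℕ∞) (dX u) := by
  rw [dX_eq_fderiv (hu.differentiable (by simp))]
  exact (hu.fderiv_right (by simp)).clm_apply contDiff_const

/-- Smooth functions on the plane solving the heat equation on the half-space `x ≥ 0` with Neumann
condition at `x = 0`. -/
structure IsNeumannHeatSolution (u : ℝ × ℝ → ℂ) : Prop where
  contDiff : ContDiff ℝ (⊤ : ℕ∞) u
  heat : ∀ t x : ℝ, 0 ≤ x → dT u (t, x) = dX (dX u) (t, x)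
  neumann : ∀ t : ℝ, dX u (t, 0) = 0

theorem dT_sub {u v : ℝ × ℝ → ℂ} (hu : Differentiable ℝ u) (hv : Differentiable ℝ v) :
    dT (fun p => u p - v p) = fun p => dT u p - dT v p := by
  ext ⟨t, x⟩
  exact ((hasDerivAt_dT hu t x).sub (hasDerivAt_dT hv t x)).deriv

theorem dX_sub {u v : ℝ × ℝ → ℂ} (hu : Differentiable ℝ u) (hv : Differentiable ℝ v) :
    dX (fun p => u p - v p) = fun p => dX u p - dX v p := by
  ext ⟨t, x⟩
  exact ((hasDerivAt_dX hu t x).sub (hasDerivAt_dX hv t x)).deriv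

theorem dX_const_mul_sum {ι : Type*} (s : Finset ι) (c : ι → ℂ) {u : ι → ℝ × ℝ → ℂ}
    (hu : ∀ i, Differentiable ℝ (u i)) :
    dX (fun p => ∑ i ∈ s, c i * u i p) = fun p => ∑ i ∈ s, c i * dX (u i) p := by
  ext ⟨t, x⟩
  exact (HasDerivAt.fun_sum fun i _ => (hasDerivAt_dX (hu i) t x).const_mul (c i)).deriv

theorem dT_const_mul_sum {ι : Type*} (s : Finset ι) (c : ι → ℂ) {u : ι → ℝ × ℝ → ℂ}
    (hu : ∀ i, Differentiable ℝ (u i)) :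
    dT (fun p => ∑ i ∈ s, c i * u i p) = fun p => ∑ i ∈ s, c i * dT (u i) p := by
  ext ⟨t, x⟩
  exact (HasDerivAt.fun_sum fun i _ => (hasDerivAt_dT (hu i) t x).const_mul (c i)).deriv

namespace IsNeumannHeatSolution

theorem differentiable {u : ℝ × ℝ → ℂ} (hu : IsNeumannHeatSolution u) : Differentiable ℝ u :=
  hu.contDiff.differentiable (by simp)

theorem differentiable_dX {u : ℝ × ℝ → ℂ} (hu : IsNeumannHeatSolution u) :
    Differentiable ℝ (dX u) :=
  (contDiff_dX hu.contDiff).differentiable (by simp)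

theorem sub {u v : ℝ × ℝ → ℂ} (hu : IsNeumannHeatSolution u) (hv : IsNeumannHeatSolution v) :
    IsNeumannHeatSolution (fun p => u p - v p) where
  contDiff := hu.contDiff.sub hv.contDiff
  heat t x hx := by
    rw [dT_sub hu.differentiable hv.differentiable, dX_sub hu.differentiable hv.differentiable,
      dX_sub hu.differentiable_dX hv.differentiable_dX]
    simp only [hu.heat t x hx, hv.heat t x hx]
  neumann t := by
    rw [dX_sub hu.differentiable hv.differentiable]
    simp only [hu.neumann, hv.neumann, sub_zero]

theorem const_mul_sum {ι : Type*} (s : Finset ι) (c : ι → ℂ) {u : ι → ℝ × ℝ → ℂ}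
    (hu : ∀ i, IsNeumannHeatSolution (u i)) :
    IsNeumannHeatSolution (fun p => ∑ i ∈ s, c i * u i p) where
  contDiff := ContDiff.sum fun i _ => contDiff_const.mul (hu i).contDiff
  heat t x hx := by
    rw [dT_const_mul_sum s c fun i => (hu i).differentiable,
      dX_const_mul_sum s c fun i => (hu i).differentiable,
      dX_const_mul_sum s c fun i => (hu i).differentiable_dX]
    exact Finset.sum_congr rfl fun i _ => by rw [(hu i).heat t x hx]
  neumann t := by
    rw [dX_const_mul_sum s c fun i => (hu i).differentiable]
    exact Finset.sum_eq_zero fun i _ => by rw [(hu i).neumann, mul_zero]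

end IsNeumannHeatSolution

theorem dX_heatNeumannBasis (ζ : ℂ) : dX (heatNeumannBasis ζ) = fun p =>
    ζ * (Complex.exp (ζ ^ 2 * (p.1 : ℂ) + ζ * (p.2 : ℂ)) -
      Complex.exp (ζ ^ 2 * (p.1 : ℂ) - ζ * (p.2 : ℂ))) := by
  ext ⟨t, x⟩
  have hx : HasDerivAt (fun s : ℝ => (ζ * (s : ℂ))) ζ x := by
    simpa using (Complex.ofRealCLM.hasDerivAt (x := x)).const_mul ζ
  have := (hx.const_add (ζ ^ 2 * (t : ℂ))).cexp.add (hx.const_sub (ζ ^ 2 * (t : ℂ))).cexp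
  refine this.deriv.trans ?_
  ring

theorem dX_dX_heatNeumannBasis (ζ : ℂ) :
    dX (dX (heatNeumannBasis ζ)) = fun p => ζ ^ 2 * heatNeumannBasis ζ p := by
  rw [dX_heatNeumannBasis]
  ext ⟨t, x⟩
  have hx : HasDerivAt (fun s : ℝ => (ζ * (s : ℂ))) ζ x := by
    simpa using (Complex.ofRealCLM.hasDerivAt (x := x)).const_mul ζ
  have := ((hx.const_add (ζ ^ 2 * (t : ℂ))).cexp.sub
    (hx.const_sub (ζ ^ 2 * (t : ℂ))).cexp).const_mul ζ
  refine this.deriv.trans ?_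
  simp only [heatNeumannBasis]
  ring

theorem dT_heatNeumannBasis (ζ : ℂ) :
    dT (heatNeumannBasis ζ) = fun p => ζ ^ 2 * heatNeumannBasis ζ p := by
  ext ⟨t, x⟩
  have ht : HasDerivAt (fun s : ℝ => (ζ ^ 2 * (s : ℂ))) (ζ ^ 2) t := by
    simpa using (Complex.ofRealCLM.hasDerivAt (x := t)).const_mul (ζ ^ 2)
  have := (ht.add_const (ζ * (x : ℂ))).cexp.add (ht.sub_const (ζ * (x : ℂ))).cexp
  refine this.deriv.trans ?_
  simp only [heatNeumannBasis]
  ring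

theorem isNeumannHeatSolution_heatNeumannBasis (ζ : ℂ) :
    IsNeumannHeatSolution (heatNeumannBasis ζ) where
  contDiff := by
    have h1 : ContDiff ℝ (⊤ : ℕ∞) (fun p : ℝ × ℝ => (p.1 : ℂ)) :=
      Complex.ofRealCLM.contDiff.comp contDiff_fst
    have h2 : ContDiff ℝ (⊤ : ℕ∞) (fun p : ℝ × ℝ => (p.2 : ℂ)) :=
      Complex.ofRealCLM.contDiff.comp contDiff_snd
    exact ((contDiff_const.mul h1).add (contDiff_const.mul h2)).cexp.add
      ((contDiff_const.mul h1).sub (contDiff_const.mul h2)).cexp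
  heat t x _ := by rw [dT_heatNeumannBasis, dX_dX_heatNeumannBasis]
  neumann t := by rw [dX_heatNeumannBasis]; simp

/-- The cosine moments of a function on `[0, R]`. -/
noncomputable def cosMoment (R μ : ℝ) (u : ℝ × ℝ → ℂ) (t : ℝ) : ℂ :=
  ∫ x in (0 : ℝ)..R, (Real.cos (μ * x) : ℂ) * u (t, x)

theorem IsNeumannHeatSolution.hasDerivAt_cosMoment {u : ℝ × ℝ → ℂ} (hu : IsNeumannHeatSolution u)
    {R μ : ℝ} (hR : 0 < R) (hμ : Real.sin (μ * R) = 0) (t : ℝ) :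
    HasDerivAt (cosMoment R μ u)
      ((Real.cos (μ * R) : ℂ) * dX u (t, R) - (μ : ℂ) ^ 2 * cosMoment R μ u t) t := by
  have hc := hu.contDiff.continuous
  have hcT := (contDiff_dT hu.contDiff).continuous
  have hcX := (contDiff_dX hu.contDiff).continuous
  have hcXX := (contDiff_dX (contDiff_dX hu.contDiff)).continuous
  obtain ⟨C, hC⟩ := (isCompact_Icc (a := t - 1) (b := t + 1)).prod (isCompact_Icc (a := 0) (b := R))
    |>.exists_bound_of_continuousOn (f := fun p : ℝ × ℝ => (Real.cos (μ * p.2) : ℂ) * dT u p)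
    (by fun_prop)
  have key := intervalIntegral.hasDerivAt_integral_of_dominated_loc_of_deriv_le
    (μ := volume) (a := 0) (b := R) (s := Set.Icc (t - 1) (t + 1)) (x₀ := t) (bound := fun _ => C)
    (F := fun t x => (Real.cos (μ * x) : ℂ) * u (t, x))
    (F' := fun t x => (Real.cos (μ * x) : ℂ) * dT u (t, x))
    (Icc_mem_nhds (by linarith) (by linarith))
    (Eventually.of_forall fun s => Continuous.aestronglyMeasurable (by fun_prop))
    (Continuous.intervalIntegrable (by fun_prop) _ _)
    (Continuous.aestronglyMeasurable (by fun_prop))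
    (Eventually.of_forall fun x hx s hs => by
      rw [Set.uIoc_of_le hR.le] at hx
      exact hC (s, x) ⟨hs, ⟨hx.1.le, hx.2⟩⟩)
    (by simp)
    (Eventually.of_forall fun x _ s _ => (hasDerivAt_dT hu.differentiable s x).const_mul _)
  refine key.2.congr_deriv ?_
  have hcos : ∀ x : ℝ, HasDerivAt (fun x : ℝ => (Real.cos (μ * x) : ℂ))
      (-(μ * Real.sin (μ * x) : ℝ)) x := fun x => by
    refine (((hasDerivAt_id' x).const_mul μ).cos).ofReal_comp.congr_deriv ?_
    push_cast; ring
  have hsin : ∀ x : ℝ, HasDerivAt (fun x : ℝ => (μ * Real.sin (μ * x) : ℂ))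
      (μ ^ 2 * Real.cos (μ * x) : ℝ) x := fun x => by
    refine ((((hasDerivAt_id' x).const_mul μ).sin).ofReal_comp.const_mul (μ : ℂ)).congr_deriv ?_
    push_cast; ring
  have hG := intervalIntegral.integral_eq_sub_of_hasDerivAt (a := 0) (b := R)
    (f := fun x => (Real.cos (μ * x) : ℂ) * dX u (t, x) + (μ * Real.sin (μ * x) : ℂ) * u (t, x))
    (f' := fun x => (Real.cos (μ * x) : ℂ) * dX (dX u) (t, x) +
      (μ : ℂ) ^ 2 * ((Real.cos (μ * x) : ℂ) * u (t, x)))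
    (fun x _ => by
      refine (((hcos x).mul (hasDerivAt_dX hu.differentiable_dX t x)).add
        ((hsin x).mul (hasDerivAt_dX hu.differentiable t x))).congr_deriv ?_
      push_cast; ring)
    (Continuous.intervalIntegrable (by fun_prop) _ _)
  rw [intervalIntegral.integral_add (Continuous.intervalIntegrable (by fun_prop) _ _)
    (Continuous.intervalIntegrable (by fun_prop) _ _), intervalIntegral.integral_const_mul] at hG
  simp only [hμ, hu.neumann, mul_zero, Real.sin_zero, Complex.ofReal_zero, zero_mul, add_zero,
    sub_zero] at hG
  rw [← hG, show cosMoment R μ u t = ∫ x in (0 : ℝ)..R, (Real.cos (μ * x) : ℂ) * u (t, x) from rfl,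
    add_sub_cancel_right]
  refine intervalIntegral.integral_congr fun x hx => ?_
  rw [Set.uIcc_of_le hR.le] at hx
  simp only [hu.heat t x hx.1]

theorem IsNeumannHeatSolution.norm_cosMoment_sub_le {u : ℝ × ℝ → ℂ}
    (hu : IsNeumannHeatSolution u) {R μ : ℝ} (hR : 0 < R) (hμ : Real.sin (μ * R) = 0) {t₀ t₁ δ : ℝ}
    (h01 : t₀ ≤ t₁) (hδ : ∀ s ∈ Set.Icc t₀ t₁, ‖dX u (s, R)‖ ≤ δ) :
    ‖cosMoment R μ u t₁ - (Real.exp (-μ ^ 2 * (t₁ - t₀)) : ℂ) * cosMoment R μ u t₀‖ ≤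
      δ * (t₁ - t₀) := by
  have hE : ∀ s, HasDerivAt (fun s => (Real.exp (μ ^ 2 * (s - t₁)) : ℂ) * cosMoment R μ u s)
      ((Real.exp (μ ^ 2 * (s - t₁)) : ℂ) * ((Real.cos (μ * R) : ℂ) * dX u (s, R))) s := by
    intro s
    refine (((((hasDerivAt_id' s).sub_const t₁).const_mul (μ ^ 2)).exp).ofReal_comp.mul
      (hu.hasDerivAt_cosMoment hR hμ s)).congr_deriv ?_
    push_cast; ring
  have h := norm_image_sub_le_of_norm_deriv_le_segment' (C := δ)
    (fun s _ => (hE s).hasDerivWithinAt) (fun s hs => by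
      rw [norm_mul, norm_mul, Complex.norm_real, Complex.norm_real, Real.norm_of_nonneg (by positivity)]
      have h1 : Real.exp (μ ^ 2 * (s - t₁)) ≤ 1 :=
        Real.exp_le_one_iff.mpr (mul_nonpos_of_nonneg_of_nonpos (sq_nonneg _) (by linarith [hs.2]))
      have h2 : ‖Real.cos (μ * R)‖ ≤ 1 := Real.abs_cos_le_one _
      have h3 := hδ s ⟨hs.1, hs.2.le⟩
      calc _ ≤ 1 * (1 * δ) := by gcongr
        _ = δ := by ring) t₁ ⟨h01, le_rfl⟩
  simp only [sub_self, mul_zero, Real.exp_zero, Complex.ofReal_one, one_mul] at h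
  rwa [show -μ ^ 2 * (t₁ - t₀) = μ ^ 2 * (t₀ - t₁) by ring]

/-- Sequences indexed by `ℤ` that decay faster than every power. -/
def IsRapidlyDecaying (a : ℤ → ℝ) : Prop :=
  ∀ p : ℕ, ∃ C, ∀ n : ℤ, a n * (1 + |(n : ℝ)|) ^ p ≤ C

theorem summable_one_div_one_add_abs_int_sq :
    Summable fun n : ℤ => 1 / (1 + |(n : ℝ)|) ^ 2 := by
  refine Summable.of_norm_bounded_eventually
    (Real.summable_one_div_int_pow.mpr one_lt_two) ?_
  filter_upwards [(Set.finite_singleton (0 : ℤ)).compl_mem_cofinite] with n hn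
  have hn' : (n : ℝ) ≠ 0 := by exact_mod_cast hn
  rw [Real.norm_of_nonneg (by positivity), ← sq_abs (n : ℝ)]
  have : 0 < |(n : ℝ)| := abs_pos.mpr hn'
  gcongr
  linarith

theorem IsRapidlyDecaying.summable {a : ℤ → ℝ} (ha : IsRapidlyDecaying a) (h0 : ∀ n, 0 ≤ a n)
    (k : ℕ) : Summable fun n : ℤ => a n * (1 + |(n : ℝ)|) ^ k := by
  obtain ⟨C, hC⟩ := ha (k + 2)
  refine Summable.of_nonneg_of_le (fun n => mul_nonneg (h0 n) (by positivity)) (fun n => ?_)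
    (summable_one_div_one_add_abs_int_sq.mul_left C)
  rw [mul_one_div, le_div_iff₀ (by positivity), mul_assoc, ← pow_add]
  exact hC n

theorem isRapidlyDecaying_exp_neg_sq {β : ℝ} (hβ : β ≠ 0) :
    IsRapidlyDecaying fun n : ℤ => Real.exp (-(β * n) ^ 2) := by
  intro p
  refine ⟨2 ^ p * (p.factorial * Real.exp (β ^ 2) / (β ^ 2) ^ p), fun n => ?_⟩
  have hβ2 : 0 < β ^ 2 := by positivity
  have h1 : (1 + |(n : ℝ)|) ^ p ≤ (2 * (1 + (n : ℝ) ^ 2)) ^ p := by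
    gcongr
    nlinarith [sq_abs (n : ℝ), sq_nonneg (|(n : ℝ)| - 1), abs_nonneg (n : ℝ)]
  have h2 := Real.pow_div_factorial_le_exp (β ^ 2 * (1 + (n : ℝ) ^ 2)) (by positivity) p
  rw [div_le_iff₀ (by positivity), mul_pow, mul_add, mul_one, Real.exp_add, ← mul_pow β] at h2
  have h3 : (1 + (n : ℝ) ^ 2) ^ p ≤
      Real.exp ((β * n) ^ 2) * (p.factorial * Real.exp (β ^ 2) / (β ^ 2) ^ p) := by
    rw [← mul_div_assoc, le_div_iff₀ (by positivity)]
    linarith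
  calc Real.exp (-(β * n) ^ 2) * (1 + |(n : ℝ)|) ^ p
      ≤ Real.exp (-(β * n) ^ 2) * (2 ^ p * (Real.exp ((β * n) ^ 2) *
          (p.factorial * Real.exp (β ^ 2) / (β ^ 2) ^ p))) := by
        gcongr
        refine h1.trans ?_
        rw [mul_pow]
        gcongr
    _ = _ := by
        rw [show ∀ a b c d : ℝ, a * (b * (c * d)) = (a * c) * (b * d) by intros; ring,
          ← Real.exp_add]
        simp

/-- The sum of the absolute values of the two exponentials making up a basis element. -/
noncomputable def heatNeumannMajorant (ζ : ℂ) (p : ℝ × ℝ) : ℝ :=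
  ‖Complex.exp (ζ ^ 2 * (p.1 : ℂ) + ζ * (p.2 : ℂ))‖ +
    ‖Complex.exp (ζ ^ 2 * (p.1 : ℂ) - ζ * (p.2 : ℂ))‖

theorem norm_iteratedFDeriv_heatNeumannBasis_le (ζ : ℂ) (k : ℕ) (p : ℝ × ℝ) :
    ‖iteratedFDeriv ℝ k (heatNeumannBasis ζ) p‖ ≤
      heatNeumannMajorant ζ p * (2 * (1 + ‖ζ‖ ^ 2)) ^ k := by
  let L (z : ℂ) : ℝ × ℝ →L[ℝ] ℂ :=
    (ζ ^ 2) • (Complex.ofRealCLM.comp (ContinuousLinearMap.fst ℝ ℝ ℝ)) +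
      z • (Complex.ofRealCLM.comp (ContinuousLinearMap.snd ℝ ℝ ℝ))
  have hLapp : ∀ z q, L z q = ζ ^ 2 * (q.1 : ℂ) + z * (q.2 : ℂ) := fun z q => by simp [L]
  have hL : ∀ z : ℂ, ‖z‖ = ‖ζ‖ → ‖L z‖ ≤ 2 * (1 + ‖ζ‖ ^ 2) := by
    intro z hz
    refine ContinuousLinearMap.opNorm_le_bound _ (by positivity) fun q => ?_
    rw [hLapp]
    calc ‖ζ ^ 2 * (q.1 : ℂ) + z * (q.2 : ℂ)‖ ≤ ‖ζ ^ 2 * (q.1 : ℂ)‖ + ‖z * (q.2 : ℂ)‖ :=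
          norm_add_le _ _
      _ = ‖ζ‖ ^ 2 * ‖q.1‖ + ‖ζ‖ * ‖q.2‖ := by simp [hz]
      _ ≤ ‖ζ‖ ^ 2 * ‖q‖ + ‖ζ‖ * ‖q‖ := by
        gcongr
        · exact norm_fst_le q
        · exact norm_snd_le q
      _ ≤ _ := by
        rw [← add_mul]
        gcongr
        nlinarith [sq_nonneg (‖ζ‖ - 1)]
  have hexp : ∀ z, ContDiff ℝ (⊤ : ℕ∞) (fun q => Complex.exp (L z q) • (1 : ℂ)) := fun z =>
    (L z).contDiff.cexp.smul contDiff_const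
  have hb : heatNeumannBasis ζ = (fun q => Complex.exp (L ζ q) • (1 : ℂ)) +
      fun q => Complex.exp (L (-ζ) q) • (1 : ℂ) := by
    ext q
    simp [hLapp, heatNeumannBasis, sub_eq_add_neg]
  have hk : ((k : ℕ∞) : WithTop ℕ∞) ≤ ((⊤ : ℕ∞) : WithTop ℕ∞) := by exact_mod_cast le_top
  rw [hb, iteratedFDeriv_add_apply ((hexp ζ).of_le hk).contDiffAt ((hexp (-ζ)).of_le hk).contDiffAt]
  refine (norm_add_le _ _).trans ?_
  rw [heatNeumannMajorant, add_mul]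
  have h : ∀ z, ‖z‖ = ‖ζ‖ → ‖iteratedFDeriv ℝ k (fun q => Complex.exp (L z q) • (1 : ℂ)) p‖ ≤
      ‖Complex.exp (ζ ^ 2 * (p.1 : ℂ) + z * (p.2 : ℂ))‖ * (2 * (1 + ‖ζ‖ ^ 2)) ^ k := by
    intro z hz
    refine (norm_iteratedFDeriv_cexp_smul_le (L z) k 1 p).trans ?_
    rw [norm_one, mul_one, hLapp]
    gcongr
    exact hL z hz
  have h2 := h (-ζ) (norm_neg ζ)
  rw [neg_mul, ← sub_eq_add_neg] at h2
  exact add_le_add (h ζ rfl) h2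

theorem norm_iteratedFDeriv_const_mul_heatNeumannBasis_le (c ζ : ℂ) (k : ℕ) (p : ℝ × ℝ) :
    ‖iteratedFDeriv ℝ k (fun q => c * heatNeumannBasis ζ q) p‖ ≤
      ‖c‖ * heatNeumannMajorant ζ p * (2 * (1 + ‖ζ‖ ^ 2)) ^ k := by
  have hk : ((k : ℕ∞) : WithTop ℕ∞) ≤ ((⊤ : ℕ∞) : WithTop ℕ∞) := by exact_mod_cast le_top
  have h := iteratedFDeriv_const_smul_apply (a := c) (x := p)
    ((isNeumannHeatSolution_heatNeumannBasis ζ).contDiff.of_le hk).contDiffAt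
  rw [show (fun q => c * heatNeumannBasis ζ q) = c • heatNeumannBasis ζ from rfl, h, norm_smul,
    mul_assoc]
  gcongr
  exact norm_iteratedFDeriv_heatNeumannBasis_le ζ k p

theorem Complex.exists_sq_eq_mul_I (w : ℝ) :
    ∃ z : ℂ, z ^ 2 = w * Complex.I ∧ z.re = √(|w| / 2) := by
  have hs : √(|w| / 2) ^ 2 = |w| / 2 := Real.sq_sqrt (by positivity)
  generalize √(|w| / 2) = r at hs ⊢
  rcases le_total 0 w with h | h
  · rw [abs_of_nonneg h] at hs
    exact ⟨⟨r, r⟩, by apply Complex.ext <;> simp [pow_two]; linarith, rfl⟩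
  · rw [abs_of_nonpos h] at hs
    exact ⟨⟨r, -r⟩, by apply Complex.ext <;> simp [pow_two]; linarith, rfl⟩

/-- Basis elements with imaginary time frequency, normalized by their Neumann data at `x = R`, are
uniformly bounded on `0 ≤ x ≤ R`. -/
theorem norm_inv_mul_heatNeumannMajorant_le {R s : ℝ} (hR : 0 < R) (hs : 0 < s) {z : ℂ} {w : ℝ}
    (hz : z ^ 2 = w * Complex.I) (hsz : s ≤ z.re) {t x : ℝ} (hx : x ∈ Set.Icc 0 R) :
    ‖(z * (Complex.exp (z * R) - Complex.exp (-(z * R))))⁻¹‖ * heatNeumannMajorant z (t, x) ≤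
      2 / (s * (1 - Real.exp (-(2 * s * R)))) := by
  have hpos : 0 < 1 - Real.exp (-(2 * s * R)) := by
    rw [sub_pos, Real.exp_lt_one_iff]
    have : 0 < 2 * s * R := by positivity
    linarith
  have hnum : heatNeumannMajorant z (t, x) ≤ 2 * Real.exp (z.re * R) := by
    have h1 : z.re * x ≤ z.re * R := mul_le_mul_of_nonneg_left hx.2 (by linarith)
    have h2 : 0 ≤ z.re * x := mul_nonneg (by linarith) hx.1
    rw [heatNeumannMajorant, hz, Complex.norm_exp, Complex.norm_exp, two_mul]
    simp only [Complex.add_re, Complex.sub_re, Complex.mul_re, Complex.mul_im, Complex.ofReal_re,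
      Complex.ofReal_im, Complex.I_re, Complex.I_im, mul_zero, zero_mul, sub_zero, mul_one,
      add_zero, zero_add]
    gcongr; linarith
  have hden : s * (Real.exp (z.re * R) * (1 - Real.exp (-(2 * s * R)))) ≤
      ‖z * (Complex.exp (z * R) - Complex.exp (-(z * R)))‖ := by
    rw [norm_mul]
    have h1 : s ≤ ‖z‖ := hsz.trans (Complex.re_le_norm z)
    have h2 := norm_sub_norm_le (Complex.exp (z * R)) (Complex.exp (-(z * R)))
    rw [Complex.norm_exp, Complex.norm_exp] at h2
    simp only [Complex.neg_re, Complex.mul_re, Complex.ofReal_re, Complex.ofReal_im, mul_zero,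
      sub_zero] at h2
    have h3 : Real.exp (-(z.re * R)) ≤ Real.exp (z.re * R) * Real.exp (-(2 * s * R)) := by
      rw [← Real.exp_add]
      gcongr
      nlinarith
    gcongr
    linarith
  have hden0 : 0 < s * (Real.exp (z.re * R) * (1 - Real.exp (-(2 * s * R)))) := by positivity
  rw [norm_inv, inv_mul_eq_div, div_le_div_iff₀ (hden0.trans_le hden) (by positivity)]
  calc heatNeumannMajorant z (t, x) * (s * (1 - Real.exp (-(2 * s * R))))
      ≤ 2 * Real.exp (z.re * R) * (s * (1 - Real.exp (-(2 * s * R)))) := by gcongr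
    _ = 2 * (s * (Real.exp (z.re * R) * (1 - Real.exp (-(2 * s * R))))) := by ring
    _ ≤ _ := by gcongr

/-- A smooth function on the line is, on any bounded interval, a rapidly converging series of
exponentials with frequencies bounded away from zero. -/
theorem exists_hasSum_exp_of_contDiff {h : ℝ → ℂ} (hh : ContDiff ℝ (⊤ : ℕ∞) h) {S : ℝ}
    (hS : 0 < S) : ∃ (a : ℝ) (γ : ℤ → ℂ), 0 < a ∧ IsRapidlyDecaying (fun n => ‖γ n‖) ∧
      ∀ t ∈ Set.Icc (-S) S,
        HasSum (fun n : ℤ => γ n * Complex.exp ((Real.pi * (n + 1 / 2) / a : ℝ) * Complex.I * t))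
          (h t) := by
  let χ : ContDiffBump (0 : ℝ) := ⟨S, S + 1, hS, by linarith⟩
  have ha : 0 < S + 2 := by linarith
  set a := S + 2 with ha_def
  let f : ℝ → ℂ := fun t =>
    (χ t : ℂ) * (Complex.exp (-((Real.pi / (2 * a) : ℝ) * Complex.I * t)) * h t)
  have hf : ContDiff ℝ (⊤ : ℕ∞) f := by
    refine ContDiff.mul (Complex.ofRealCLM.contDiff.comp χ.contDiff) (ContDiff.mul ?_ hh)
    exact (contDiff_const.mul Complex.ofRealCLM.contDiff).neg.cexp
  have hz : ∀ t, t ∉ Metric.closedBall (0 : ℝ) (S + 1) → f t = 0 := by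
    intro t ht
    have : χ t = 0 := image_eq_zero_of_notMem_tsupport (by rwa [χ.tsupport_eq])
    simp [f, this]
  have hsupp : tsupport f ⊆ Set.Ioo (-a) a := by
    have h1 : tsupport f ⊆ Metric.closedBall (0 : ℝ) (S + 1) :=
      closure_minimal (fun t ht => by_contra fun hcon => ht (hz t hcon)) Metric.isClosed_closedBall
    refine h1.trans fun t ht => ?_
    rw [Real.closedBall_eq_Icc] at ht
    exact ⟨by linarith [ht.1], by linarith [ht.2]⟩
  have hdecay : IsRapidlyDecaying fun n => ‖symmFourierCoeff a f n‖ := fun p =>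
    exists_symmFourierCoeff_decay ha p hf hsupp
  refine ⟨a, symmFourierCoeff a f, ha, hdecay, fun t ht => ?_⟩
  have hends : ∀ t, t ∉ Set.Ioo (-a) a → f t = 0 := fun t ht =>
    image_eq_zero_of_notMem_tsupport fun h => ht (hsupp h)
  have hs : Summable (symmFourierCoeff a f) := by
    refine Summable.of_norm ?_
    simpa using hdecay.summable (fun _ => norm_nonneg _) 0
  have h1 := (hasSum_symmFourierCoeff ha hf.continuous.continuousOn
    (by rw [hends a (by simp), hends (-a) (by simp)]) hs (t := t)
    ⟨by linarith [ht.1], by linarith [ht.2]⟩).mul_right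
      (Complex.exp ((Real.pi / (2 * a) : ℝ) * Complex.I * t))
  have hχ : χ t = 1 := χ.one_of_mem_closedBall (by
    rw [Real.closedBall_eq_Icc]
    exact ⟨by linarith [ht.1], by linarith [ht.2]⟩)
  have h2 : f t * Complex.exp ((Real.pi / (2 * a) : ℝ) * Complex.I * t) = h t := by
    simp only [f, hχ, Complex.ofReal_one, one_mul]
    rw [mul_right_comm, ← Complex.exp_add, neg_add_cancel, Complex.exp_zero, one_mul]
  rw [h2] at h1
  convert! h1 using 2 with n
  rw [mul_assoc (symmFourierCoeff a f n), ← Complex.exp_add]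
  congr 2
  push_cast
  have : (a : ℂ) ≠ 0 := by exact_mod_cast ha.ne'
  field_simp

theorem HasSum.norm_sub_sum_le_tsum_compl {ι E : Type*} [NormedAddCommGroup E] {f : ι → E} {a : E}
    (hf : HasSum f a) {g : ι → ℝ} (hg : Summable g) (hb : ∀ i, ‖f i‖ ≤ g i) (s : Finset ι) :
    ‖a - ∑ i ∈ s, f i‖ ≤ ∑' i : {i // i ∉ s}, g i := by
  have h : HasSum (fun i : {i // i ∉ s} => f i) (a - ∑ i ∈ s, f i) := by
    rw [Finset.hasSum_compl_iff, sub_add_cancel]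
    exact hf
  exact h.norm_le_of_bounded (hg.subtype _).hasSum fun i => hb i

/-- A series `∑ cᵢ b_{ζᵢ}` of basis elements that converges, together with all derivatives, normally
on `D`. -/
structure IsDominatedSeries {ι : Type*} (D : Set (ℝ × ℝ)) (ζ c : ι → ℂ) (B : ι → ℝ) : Prop where
  summable : ∀ k : ℕ, Summable fun i => B i * (2 * (1 + ‖ζ i‖ ^ 2)) ^ k
  le : ∀ i, ∀ p ∈ D, ‖c i‖ * heatNeumannMajorant (ζ i) p ≤ B i

namespace IsDominatedSeries

variable {ι : Type*} {D : Set (ℝ × ℝ)} {ζ c : ι → ℂ} {B : ι → ℝ}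

theorem summable_bound (h : IsDominatedSeries D ζ c B) : Summable B := by
  simpa using h.summable 0

theorem norm_iteratedFDeriv_le (h : IsDominatedSeries D ζ c B) (k : ℕ) (i : ι) {p : ℝ × ℝ}
    (hp : p ∈ D) : ‖iteratedFDeriv ℝ k (fun q => c i * heatNeumannBasis (ζ i) q) p‖ ≤
      B i * (2 * (1 + ‖ζ i‖ ^ 2)) ^ k :=
  (norm_iteratedFDeriv_const_mul_heatNeumannBasis_le _ _ k p).trans
    (mul_le_mul_of_nonneg_right (h.le i p hp) (by positivity))

theorem norm_le (h : IsDominatedSeries D ζ c B) (i : ι) {p : ℝ × ℝ} (hp : p ∈ D) :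
    ‖c i * heatNeumannBasis (ζ i) p‖ ≤ B i := by
  simpa using h.norm_iteratedFDeriv_le 0 i hp

theorem norm_dX_le (h : IsDominatedSeries D ζ c B) (i : ι) {p : ℝ × ℝ} (hp : p ∈ D) :
    ‖c i * dX (heatNeumannBasis (ζ i)) p‖ ≤ B i * (2 * (1 + ‖ζ i‖ ^ 2)) ^ 1 := by
  have h1 : ‖dX (heatNeumannBasis (ζ i)) p‖ ≤ ‖ζ i‖ * heatNeumannMajorant (ζ i) p := by
    rw [dX_heatNeumannBasis, norm_mul]
    exact mul_le_mul_of_nonneg_left (norm_sub_le _ _) (norm_nonneg _)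
  have h2 : ‖ζ i‖ ≤ 2 * (1 + ‖ζ i‖ ^ 2) := by nlinarith [sq_nonneg (‖ζ i‖ - 1)]
  calc ‖c i * dX (heatNeumannBasis (ζ i)) p‖
      ≤ ‖c i‖ * (‖ζ i‖ * heatNeumannMajorant (ζ i) p) := by rw [norm_mul]; gcongr
    _ = ‖c i‖ * heatNeumannMajorant (ζ i) p * ‖ζ i‖ := by ring
    _ ≤ B i * (2 * (1 + ‖ζ i‖ ^ 2)) :=
        mul_le_mul (h.le i p hp) h2 (norm_nonneg _)
          ((norm_nonneg _).trans (h.norm_le i hp))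
    _ = _ := by rw [pow_one]

theorem mono (h : IsDominatedSeries D ζ c B) {D' : Set (ℝ × ℝ)} (hD : D' ⊆ D) :
    IsDominatedSeries D' ζ c B :=
  ⟨h.summable, fun i p hp => h.le i p (hD hp)⟩

theorem hasSum (h : IsDominatedSeries D ζ c B) {p : ℝ × ℝ} (hp : p ∈ D) :
    HasSum (fun i => c i * heatNeumannBasis (ζ i) p) (∑' i, c i * heatNeumannBasis (ζ i) p) :=
  (Summable.of_norm_bounded h.summable_bound fun i => h.norm_le i hp).hasSum

theorem sumElim {ι' : Type*} {ζ' c' : ι' → ℂ} {B' : ι' → ℝ} (h : IsDominatedSeries D ζ c B)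
    (h' : IsDominatedSeries D ζ' c' B') :
    IsDominatedSeries D (Sum.elim ζ ζ') (Sum.elim c c') (Sum.elim B B') where
  summable k := Summable.sum _ (h.summable k) (h'.summable k)
  le i := by
    cases i with
    | inl i => exact h.le i
    | inr i => exact h'.le i

theorem continuousOn_tsum (h : IsDominatedSeries D ζ c B) :
    ContinuousOn (fun p => ∑' i, c i * heatNeumannBasis (ζ i) p) D :=
  _root_.continuousOn_tsum
    (fun i => (continuous_const.mul
      (isNeumannHeatSolution_heatNeumannBasis (ζ i)).contDiff.continuous).continuousOn)
    h.summable_bound fun i _ hp => h.norm_le i hp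

end IsDominatedSeries

/-- Any smooth Neumann data at `x = R` is matched, on a bounded time interval, by a normally
convergent series of basis elements. -/
theorem exists_isDominatedSeries_hasSum_dX {h : ℝ → ℂ} (hh : ContDiff ℝ (⊤ : ℕ∞) h) {R S : ℝ}
    (hR : 0 < R) (hS : 0 < S) : ∃ (ζ c : ℤ → ℂ) (B : ℤ → ℝ),
      IsDominatedSeries (Set.Icc (-S) S ×ˢ Set.Icc 0 R) ζ c B ∧
      ∀ t ∈ Set.Icc (-S) S, HasSum (fun n => c n * dX (heatNeumannBasis (ζ n)) (t, R)) (h t) := by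
  obtain ⟨a, γ, ha, hγ, hsum⟩ := exists_hasSum_exp_of_contDiff hh hS
  let w : ℤ → ℝ := fun n => Real.pi * (n + 1 / 2) / a
  choose z hz hzre using fun n => Complex.exists_sq_eq_mul_I (w n)
  have hw : ∀ n, |w n| = Real.pi / a * |(n : ℝ) + 1 / 2| := fun n => by
    simp only [w]
    rw [mul_div_right_comm, abs_mul, abs_of_pos (div_pos Real.pi_pos ha)]
  have hw_le : ∀ n, |w n| ≤ Real.pi / a * (1 + |(n : ℝ)|) := fun n => by
    rw [hw]
    gcongr
    refine (abs_add_le _ _).trans ?_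
    rw [abs_of_pos (by norm_num : (0 : ℝ) < 1 / 2)]
    linarith
  have hw_ge : ∀ n, Real.pi / (2 * a) ≤ |w n| := fun n => by
    rw [hw, show Real.pi / (2 * a) = Real.pi / a * (1 / 2) by field_simp]
    gcongr
    rcases le_or_gt 0 n with hn | hn
    · have : (0 : ℝ) ≤ n := by exact_mod_cast hn
      rw [abs_of_nonneg (by linarith)]
      linarith
    · have : (n : ℝ) ≤ -1 := by exact_mod_cast Int.le_sub_one_of_lt hn
      rw [abs_of_nonpos (by linarith)]
      linarith
  set s := √(Real.pi / (2 * a) / 2) with hs_def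
  have hs : 0 < s := Real.sqrt_pos.mpr (by have := Real.pi_pos; positivity)
  have hsz : ∀ n, s ≤ (z n).re := fun n => by
    rw [hzre]
    exact Real.sqrt_le_sqrt (by linarith [hw_ge n])
  have hnorm : ∀ n, ‖z n‖ ^ 2 = |w n| := fun n => by
    rw [← norm_pow, hz]
    simp
  set C := 2 / (s * (1 - Real.exp (-(2 * s * R)))) with hC
  refine ⟨z, fun n => γ n * (z n * (Complex.exp (z n * R) - Complex.exp (-(z n * R))))⁻¹,
    fun n => ‖γ n‖ * C, ⟨fun k => ?_, fun n p hp => ?_⟩, fun t ht => ?_⟩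
  · have hC0 : 0 ≤ C := by
      have := norm_inv_mul_heatNeumannMajorant_le hR hs (hz 0) (hsz 0) (t := 0) (x := 0)
        ⟨le_rfl, hR.le⟩
      refine le_trans (mul_nonneg (norm_nonneg _) ?_) this
      exact add_nonneg (norm_nonneg _) (norm_nonneg _)
    refine Summable.of_nonneg_of_le (fun n => by positivity) (fun n => ?_)
      ((hγ.summable (fun _ => norm_nonneg _) k).mul_left (C * (2 * (1 + Real.pi / a)) ^ k))
    have h1 : 2 * (1 + ‖z n‖ ^ 2) ≤ 2 * (1 + Real.pi / a) * (1 + |(n : ℝ)|) := by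
      rw [hnorm]
      nlinarith [hw_le n, abs_nonneg (n : ℝ)]
    calc ‖γ n‖ * C * (2 * (1 + ‖z n‖ ^ 2)) ^ k
        ≤ ‖γ n‖ * C * (2 * (1 + Real.pi / a) * (1 + |(n : ℝ)|)) ^ k := by gcongr
      _ = _ := by rw [mul_pow]; ring
  · rw [norm_mul, mul_assoc]
    gcongr
    exact norm_inv_mul_heatNeumannMajorant_le hR hs (hz n) (hsz n) hp.2
  · convert! hsum t ht using 2 with n
    have h0 : z n * (Complex.exp (z n * R) - Complex.exp (-(z n * R))) ≠ 0 := by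
      refine mul_ne_zero (fun h0 => ?_) (sub_ne_zero.mpr fun h0 => ?_)
      · have := hsz n
        rw [h0, Complex.zero_re] at this
        linarith
      · have h1 := congrArg norm h0
        rw [Complex.norm_exp, Complex.norm_exp, Real.exp_eq_exp] at h1
        simp only [Complex.neg_re, Complex.mul_re, Complex.ofReal_re, Complex.ofReal_im, mul_zero,
          sub_zero] at h1
        nlinarith [mul_pos (hs.trans_le (hsz n)) hR]
    rw [dX_heatNeumannBasis]
    simp only [sub_eq_add_neg, Complex.exp_add] at h0 ⊢
    rw [← mul_neg (Complex.exp _), ← mul_add, mul_left_comm (z n), mul_assoc,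
      mul_left_comm _ (Complex.exp _), inv_mul_cancel₀ h0, mul_one, hz]

/-- Subtracting a series with the same Neumann data at `x = R` leaves a function whose cosine moments
decay like those of a solution that is insulated at both ends. -/
theorem IsNeumannHeatSolution.cosMoment_sub_tsum {ι : Type*} [Countable ι] {u : ℝ × ℝ → ℂ}
    (hu : IsNeumannHeatSolution u) {ζ c : ι → ℂ} {B : ι → ℝ} {R μ S : ℝ} (hR : 0 < R)
    (hμ : Real.sin (μ * R) = 0)
    (hB : IsDominatedSeries (Set.Icc (-S) S ×ˢ Set.Icc 0 R) ζ c B)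
    (hsum : ∀ t ∈ Set.Icc (-S) S,
      HasSum (fun n => c n * dX (heatNeumannBasis (ζ n)) (t, R)) (dX u (t, R)))
    {t₀ t₁ : ℝ} (h0 : t₀ ∈ Set.Icc (-S) S) (h1 : t₁ ∈ Set.Icc (-S) S) (h01 : t₀ ≤ t₁) :
    cosMoment R μ (fun p => u p - ∑' i, c i * heatNeumannBasis (ζ i) p) t₁ =
      (Real.exp (-μ ^ 2 * (t₁ - t₀)) : ℂ) *
        cosMoment R μ (fun p => u p - ∑' i, c i * heatNeumannBasis (ζ i) p) t₀ := by
  let w : Finset ι → ℝ × ℝ → ℂ := fun s p => u p - ∑ i ∈ s, c i * heatNeumannBasis (ζ i) p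
  have hw : ∀ s, IsNeumannHeatSolution (w s) := fun s =>
    hu.sub (.const_mul_sum s c fun i => isNeumannHeatSolution_heatNeumannBasis (ζ i))
  have hlim : ∀ t ∈ Set.Icc (-S) S, Tendsto (fun s => cosMoment R μ (w s) t) atTop
      (𝓝 (cosMoment R μ (fun p => u p - ∑' i, c i * heatNeumannBasis (ζ i) p) t)) := by
    intro t ht
    obtain ⟨M, hM⟩ := (isCompact_Icc (a := 0) (b := R)).exists_bound_of_continuousOn
      (f := fun x => u (t, x)) (by have := hu.contDiff.continuous; fun_prop)
    refine intervalIntegral.tendsto_integral_filter_of_dominated_convergence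
      (fun _ => 1 * (M + ∑' i, B i)) (Eventually.of_forall fun s => ?_)
      (Eventually.of_forall fun s => Eventually.of_forall fun x hx => ?_) (by simp)
      (Eventually.of_forall fun x hx => ?_)
    · have := (hw s).contDiff.continuous
      exact Continuous.aestronglyMeasurable (by fun_prop)
    · rw [Set.uIoc_of_le hR.le] at hx
      have hp : (t, x) ∈ Set.Icc (-S) S ×ˢ Set.Icc 0 R := ⟨ht, hx.1.le, hx.2⟩
      rw [norm_mul, Complex.norm_real]
      refine mul_le_mul (Real.abs_cos_le_one _) ?_ (norm_nonneg _) zero_le_one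
      refine (norm_sub_le _ _).trans (add_le_add (hM x ⟨hx.1.le, hx.2⟩) ?_)
      refine (norm_sum_le_of_le s fun i _ => hB.norm_le i hp).trans ?_
      exact hB.summable_bound.sum_le_tsum s fun i _ => (norm_nonneg _).trans (hB.norm_le i hp)
    · rw [Set.uIoc_of_le hR.le] at hx
      exact ((hB.hasSum (p := (t, x)) ⟨ht, hx.1.le, hx.2⟩).const_sub _).const_mul _
  have hle : ∀ s, ‖cosMoment R μ (w s) t₁ -
      (Real.exp (-μ ^ 2 * (t₁ - t₀)) : ℂ) * cosMoment R μ (w s) t₀‖ ≤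
      (∑' i : {i // i ∉ s}, B i * (2 * (1 + ‖ζ i‖ ^ 2)) ^ 1) * (t₁ - t₀) := by
    intro s
    refine (hw s).norm_cosMoment_sub_le hR hμ h01 fun t ht => ?_
    have ht' : t ∈ Set.Icc (-S) S := ⟨h0.1.trans ht.1, ht.2.trans h1.2⟩
    have hb := fun i => (isNeumannHeatSolution_heatNeumannBasis (ζ i)).differentiable
    simp only [w]
    rw [dX_sub hu.differentiable
      (IsNeumannHeatSolution.const_mul_sum s c fun i =>
        isNeumannHeatSolution_heatNeumannBasis (ζ i)).differentiable, dX_const_mul_sum s c hb]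
    exact (hsum t ht').norm_sub_sum_le_tsum_compl (hB.summable 1)
      (fun i => hB.norm_dX_le i (p := (t, R)) ⟨ht', hR.le, le_rfl⟩) s
  have hz := le_of_tendsto_of_tendsto ((hlim t₁ h1).sub ((hlim t₀ h0).const_mul _)).norm
    ((tendsto_tsum_compl_atTop_zero
      fun i => B i * (2 * (1 + ‖ζ i‖ ^ 2)) ^ 1).mul_const (t₁ - t₀)) (Eventually.of_forall hle)
  rw [zero_mul] at hz
  exact sub_eq_zero.mp (norm_le_zero_iff.mp hz)

theorem heatNeumannBasis_mul_I (μ t x : ℝ) : heatNeumannBasis (μ * Complex.I) (t, x) =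
    2 * (Real.exp (-μ ^ 2 * t) : ℂ) * (Real.cos (μ * x) : ℂ) := by
  have h : ((μ : ℂ) * Complex.I) ^ 2 * t = -μ ^ 2 * t := by rw [mul_pow, Complex.I_sq]; ring
  simp only [heatNeumannBasis, h, sub_eq_add_neg, Complex.exp_add]
  push_cast
  rw [Complex.cos]
  ring_nf

theorem heatNeumannMajorant_mul_I (μ t x : ℝ) :
    heatNeumannMajorant (μ * Complex.I) (t, x) = 2 * Real.exp (-μ ^ 2 * t) := by
  have h : ((μ : ℂ) * Complex.I) ^ 2 * t = (-μ ^ 2 * t : ℝ) := by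
    rw [mul_pow, Complex.I_sq]; push_cast; ring
  rw [heatNeumannMajorant, h, Complex.norm_exp, Complex.norm_exp, two_mul]
  simp only [Complex.add_re, Complex.sub_re, Complex.mul_re, Complex.mul_im, Complex.ofReal_re,
    Complex.ofReal_im, Complex.I_re, Complex.I_im, mul_zero, zero_mul, sub_zero, add_zero]

/-- A continuous function whose cosine moments decay like those of an insulated heat flow is a
normally convergent series of basis elements after unit time. -/
theorem exists_isDominatedSeries_hasSum_of_cosMoment {w : ℝ × ℝ → ℂ} {R T : ℝ} (hR : 0 < R)
    (hT : 0 < T) (hw : ContinuousOn w (Set.Icc (-(T + 1)) (T + 1) ×ˢ Set.Icc 0 R))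
    (hmom : ∀ n : ℤ, ∀ t ∈ Set.Icc (-T) T, cosMoment R (Real.pi * n / R) w t =
      (Real.exp (-(Real.pi * n / R) ^ 2 * (t - -(T + 1))) : ℂ) *
        cosMoment R (Real.pi * n / R) w (-(T + 1))) :
    ∃ (ζ c : ℤ → ℂ) (B : ℤ → ℝ), IsDominatedSeries (Set.Icc (-T) T ×ˢ Set.Icc 0 R) ζ c B ∧
      ∀ p ∈ Set.Icc (-T) T ×ˢ Set.Icc 0 R,
        HasSum (fun n => c n * heatNeumannBasis (ζ n) p) (w p) := by
  obtain ⟨M, hM⟩ := (isCompact_Icc.prod isCompact_Icc).exists_bound_of_continuousOn hw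
  have hM0 : 0 ≤ M := (norm_nonneg _).trans
    (hM (0, 0) ⟨⟨by linarith, by linarith⟩, le_rfl, hR.le⟩)
  let μ : ℤ → ℝ := fun n => Real.pi * n / R
  let A : ℤ → ℂ := fun n => cosMoment R (μ n) w (-(T + 1))
  have hA : ∀ n, ‖A n‖ ≤ M * R := fun n => by
    have := intervalIntegral.norm_integral_le_of_norm_le_const (a := 0) (b := R) (C := M)
      (f := fun x => (Real.cos (μ n * x) : ℂ) * w (-(T + 1), x)) fun x hx => by
        rw [Set.uIoc_of_le hR.le] at hx
        rw [norm_mul, Complex.norm_real]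
        refine (mul_le_mul (Real.abs_cos_le_one _)
          (hM (_, x) ⟨⟨le_rfl, by linarith⟩, hx.1.le, hx.2⟩) (norm_nonneg _) zero_le_one).trans_eq
          (one_mul M)
    rwa [sub_zero, abs_of_pos hR] at this
  let d : ℤ → ℂ := fun n => ((1 / (2 * R) * Real.exp (-μ n ^ 2 * (T + 1)) : ℝ) : ℂ) * A n
  have hdom : IsDominatedSeries (Set.Icc (-T) T ×ˢ Set.Icc 0 R) (fun n => μ n * Complex.I) d
      (fun n => M * Real.exp (-(Real.pi / R * n) ^ 2)) := by
    refine ⟨fun k => ?_, fun n => ?_⟩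
    · have hβ : Real.pi / R ≠ 0 := (div_pos Real.pi_pos hR).ne'
      refine Summable.of_nonneg_of_le (fun n => by positivity) (fun n => ?_)
        (((isRapidlyDecaying_exp_neg_sq hβ).summable (fun _ => (Real.exp_pos _).le)
          (2 * k)).mul_left (M * (2 * (1 + (Real.pi / R) ^ 2)) ^ k))
      have h1 : 2 * (1 + ‖(μ n : ℂ) * Complex.I‖ ^ 2) ≤
          2 * (1 + (Real.pi / R) ^ 2) * (1 + |(n : ℝ)|) ^ 2 := by
        rw [norm_mul, Complex.norm_I, mul_one, Complex.norm_real, Real.norm_eq_abs, sq_abs,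
          show μ n = Real.pi / R * n from mul_div_right_comm _ _ _, mul_pow, ← sq_abs (n : ℝ)]
        nlinarith [abs_nonneg (n : ℝ), sq_nonneg (Real.pi / R),
          mul_nonneg (sq_nonneg (Real.pi / R)) (abs_nonneg (n : ℝ))]
      calc _ ≤ M * Real.exp (-(Real.pi / R * n) ^ 2) *
            (2 * (1 + (Real.pi / R) ^ 2) * (1 + |(n : ℝ)|) ^ 2) ^ k := by gcongr
        _ = _ := by
          rw [mul_pow (2 * (1 + (Real.pi / R) ^ 2)), ← pow_mul]
          ring
    · rintro ⟨t, x⟩ ⟨ht, hx⟩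
      rw [heatNeumannMajorant_mul_I, norm_mul, Complex.norm_real,
        Real.norm_of_nonneg (by positivity)]
      have hexp : Real.exp (-μ n ^ 2 * (T + 1)) * Real.exp (-μ n ^ 2 * t) ≤
          Real.exp (-(Real.pi / R * n) ^ 2) := by
        rw [← Real.exp_add, ← show μ n = Real.pi / R * n from mul_div_right_comm _ _ _]
        gcongr
        nlinarith [ht.1, sq_nonneg (μ n)]
      calc _ = ‖A n‖ / R * (Real.exp (-μ n ^ 2 * (T + 1)) * Real.exp (-μ n ^ 2 * t)) := by
            field_simp
        _ ≤ M * R / R * Real.exp (-(Real.pi / R * n) ^ 2) := by gcongr; exact hA n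
        _ = _ := by rw [mul_div_cancel_right₀ _ hR.ne']
  refine ⟨_, d, _, hdom, ?_⟩
  rintro ⟨t, x⟩ ⟨ht, hx⟩
  let α : ℤ → ℂ := fun n => (1 / R : ℝ) * cosMoment R (μ n) w t
  have hα : ∀ n x, d n * heatNeumannBasis (μ n * Complex.I) (t, x) =
      α n * (Real.cos (μ n * x) : ℂ) := by
    intro n x
    have h1 : (Real.exp (-μ n ^ 2 * (t - -(T + 1))) : ℂ) =
        (Real.exp (-μ n ^ 2 * (T + 1)) : ℂ) * (Real.exp (-μ n ^ 2 * t) : ℂ) := by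
      rw [← Complex.ofReal_mul, ← Real.exp_add]
      congr 2
      ring
    have h2 : cosMoment R (μ n) w t = (Real.exp (-μ n ^ 2 * (t - -(T + 1))) : ℂ) * A n :=
      hmom n t ht
    rw [heatNeumannBasis_mul_I]
    simp only [α, d, h2, h1]
    push_cast
    field_simp
  have hsum : Summable α := by
    refine Summable.of_norm_bounded hdom.summable_bound fun n => ?_
    have := hdom.norm_le n (p := (t, 0)) ⟨ht, le_rfl, hR.le⟩
    rwa [hα, mul_zero, Real.cos_zero, Complex.ofReal_one, mul_one] at this
  have hslice : ContinuousOn (fun x => w (t, x)) (Set.Icc 0 R) :=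
    hw.comp (by fun_prop) fun y hy => ⟨⟨by linarith [ht.1], by linarith [ht.2]⟩, hy⟩
  have := hasSum_cosine_series hR hslice (α := α) (fun n => rfl) hsum hx
  exact this.congr_fun fun n => hα n x

theorem IsNeumannHeatSolution.exists_isDominatedSeries_hasSum {u : ℝ × ℝ → ℂ}
    (hu : IsNeumannHeatSolution u) {R T : ℝ} (hR : 0 < R) (hT : 0 < T) :
    ∃ (ζ c : ℤ ⊕ ℤ → ℂ) (B : ℤ ⊕ ℤ → ℝ),
      IsDominatedSeries (Set.Icc (-T) T ×ˢ Set.Icc 0 R) ζ c B ∧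
      ∀ p ∈ Set.Icc (-T) T ×ˢ Set.Icc 0 R,
        HasSum (fun n => c n * heatNeumannBasis (ζ n) p) (u p) := by
  have hS : 0 < T + 1 := by linarith
  have hsub : Set.Icc (-T) T ⊆ Set.Icc (-(T + 1)) (T + 1) :=
    Set.Icc_subset_Icc (by linarith) (by linarith)
  have hsub' : Set.Icc (-T) T ×ˢ Set.Icc 0 R ⊆ Set.Icc (-(T + 1)) (T + 1) ×ˢ Set.Icc 0 R :=
    Set.prod_mono hsub le_rfl
  obtain ⟨ζ, c, B, hB, hsum⟩ := exists_isDominatedSeries_hasSum_dX (h := fun t => dX u (t, R))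
    ((contDiff_dX hu.contDiff).comp (contDiff_id.prodMk contDiff_const)) hR hS
  obtain ⟨ζ', c', B', hB', hsum'⟩ := exists_isDominatedSeries_hasSum_of_cosMoment hR hT
    (hu.contDiff.continuous.continuousOn.sub hB.continuousOn_tsum) fun n t ht =>
      hu.cosMoment_sub_tsum hR
        (by rw [div_mul_cancel₀ _ hR.ne', mul_comm]; exact Real.sin_int_mul_pi n) hB hsum
        ⟨le_rfl, by linarith⟩ (hsub ht) (hsub ht).1
  refine ⟨_, _, _, (hB.mono hsub').sumElim hB', fun p hp => ?_⟩
  have := HasSum.sum (f := fun i => Sum.elim c c' i * heatNeumannBasis (Sum.elim ζ ζ' i) p)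
    (hB.hasSum (hsub' hp)) (hsum' p hp)
  simpa only [Pi.sub_apply, add_sub_cancel] using this

theorem IsNeumannHeatSolution.exists_finset_norm_iteratedFDeriv_sub_le {ι : Type*}
    {u : ℝ × ℝ → ℂ} (hu : IsNeumannHeatSolution u) {D : Set (ℝ × ℝ)} (hD : IsOpen D)
    {ζ c : ι → ℂ} {B : ι → ℝ} (hB : IsDominatedSeries D ζ c B)
    (hsum : ∀ p ∈ D, HasSum (fun i => c i * heatNeumannBasis (ζ i) p) (u p)) (m : ℕ) {ε : ℝ}
    (hε : 0 < ε) : ∃ s : Finset ι, ∀ k ≤ m, ∀ p ∈ closure D,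
      ‖iteratedFDeriv ℝ k (fun q => u q - ∑ i ∈ s, c i * heatNeumannBasis (ζ i) q) p‖ ≤ ε := by
  have htail : ∀ᶠ s : Finset ι in atTop, ∀ k ∈ Finset.range (m + 1),
      ∑' i : {i // i ∉ s}, B i * (2 * (1 + ‖ζ i‖ ^ 2)) ^ k ≤ ε := by
    rw [Filter.eventually_all_finset]
    exact fun k _ => (tendsto_tsum_compl_atTop_zero
      fun i => B i * (2 * (1 + ‖ζ i‖ ^ 2)) ^ k).eventually_le_const hε
  obtain ⟨s, hs⟩ := htail.exists
  refine ⟨s, fun k hk => ?_⟩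
  have hsm : ∀ i, ContDiff ℝ (⊤ : ℕ∞) fun q => c i * heatNeumannBasis (ζ i) q := fun i =>
    contDiff_const.mul (isNeumannHeatSolution_heatNeumannBasis (ζ i)).contDiff
  have hk' : ((k : ℕ∞) : WithTop ℕ∞) ≤ ((⊤ : ℕ∞) : WithTop ℕ∞) := by exact_mod_cast le_top
  have hdiff : ContDiff ℝ (⊤ : ℕ∞) fun q => u q - ∑ i ∈ s, c i * heatNeumannBasis (ζ i) q :=
    hu.contDiff.sub (ContDiff.sum fun i _ => hsm i)
  suffices h : D ⊆ {p | ‖iteratedFDeriv ℝ k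
      (fun q => u q - ∑ i ∈ s, c i * heatNeumannBasis (ζ i) q) p‖ ≤ ε} from
    fun p hp => closure_minimal h
      (isClosed_le (hdiff.continuous_iteratedFDeriv hk').norm continuous_const) hp
  intro p hp
  have h := hasSum_iteratedFDeriv_of_isOpen hD hsm hB.summable
    (fun k i x hx => hB.norm_iteratedFDeriv_le k i hx) hsum k p hp
  have h2 := h.norm_sub_sum_le_tsum_compl (hB.summable k)
    (fun i => hB.norm_iteratedFDeriv_le k i hp) s
  have h3 : iteratedFDeriv ℝ k (fun q => u q - ∑ i ∈ s, c i * heatNeumannBasis (ζ i) q) p =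
      iteratedFDeriv ℝ k u p -
        ∑ i ∈ s, iteratedFDeriv ℝ k (fun q => c i * heatNeumannBasis (ζ i) q) p := by
    rw [← iteratedFDeriv_fun_sum_apply fun i _ => ((hsm i).of_le hk').contDiffAt]
    exact iteratedFDeriv_sub_apply (hu.contDiff.of_le hk').contDiffAt
      (ContDiff.sum fun i _ => (hsm i).of_le hk').contDiffAt
  rw [Set.mem_ofPred_eq, h3]
  exact h2.trans (hs k (Finset.mem_range_succ_iff.mpr hk))

/-- The B-EPGP basis `{e^{ζ²t+ζx} + e^{ζ²t−ζx}}` has dense span in the smooth solutions of the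
1D heat equation on the halfspace `{x ≥ 0}` with Neumann boundary condition at `x = 0`. -/
theorem bepgp_heat1D_neumann_dense
    (u : ℝ × ℝ → ℂ) (hu : ContDiff ℝ (⊤ : ℕ∞) u)
    (hheat : ∀ t x : ℝ, 0 ≤ x → dT u (t, x) = dX (dX u) (t, x))
    (hbc : ∀ t : ℝ, dX u (t, 0) = 0)
    (K : Set (ℝ × ℝ)) (hKc : IsCompact K) (hK : K ⊆ Set.univ ×ˢ Set.Ici (0 : ℝ))
    (m : ℕ) (ε : ℝ) (hε : 0 < ε) :
    ∃ (r : ℕ) (ζ : Fin r → ℂ) (c : Fin r → ℂ),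
      ∀ k ≤ m, ∀ p ∈ K,
        ‖iteratedFDeriv ℝ k (fun q => u q - ∑ j, c j * heatNeumannBasis (ζ j) q) p‖ ≤ ε := by
  have hsol : IsNeumannHeatSolution u := ⟨hu, hheat, hbc⟩
  obtain ⟨C, hC⟩ := hKc.isBounded.exists_norm_le
  set T := |C| + 1
  have hT : 0 < T := by positivity
  have hsub : K ⊆ closure (Set.Ioo (-T) T ×ˢ Set.Ioo 0 T) := by
    intro p hp
    have hpT : ‖p‖ ≤ T := (hC p hp).trans (by linarith [le_abs_self C])
    have h1 := abs_le.mp ((norm_fst_le p).trans hpT)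
    have h2 := abs_le.mp ((norm_snd_le p).trans hpT)
    rw [closure_prod_eq, closure_Ioo (by linarith), closure_Ioo hT.ne]
    exact ⟨h1, (hK hp).2, h2.2⟩
  have hIoo : Set.Ioo (-T) T ×ˢ Set.Ioo 0 T ⊆ Set.Icc (-T) T ×ˢ Set.Icc 0 T :=
    Set.prod_mono Set.Ioo_subset_Icc_self Set.Ioo_subset_Icc_self
  obtain ⟨ζ, c, B, hB, hsum⟩ := hsol.exists_isDominatedSeries_hasSum hT hT
  obtain ⟨s, hs⟩ := hsol.exists_finset_norm_iteratedFDeriv_sub_le (isOpen_Ioo.prod isOpen_Ioo)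
    (hB.mono hIoo) (fun p hp => hsum p (hIoo hp)) m hε
  refine ⟨s.card, fun j => ζ (s.equivFin.symm j), fun j => c (s.equivFin.symm j),
    fun k hk p hp => ?_⟩
  have hre : ∀ q, ∑ j, c (s.equivFin.symm j) * heatNeumannBasis (ζ (s.equivFin.symm j)) q =
      ∑ i ∈ s, c i * heatNeumannBasis (ζ i) q := fun q => by
    rw [Equiv.sum_comp s.equivFin.symm fun i : s => c i * heatNeumannBasis (ζ i) q]
    exact Finset.sum_coe_sort s fun i => c i * heatNeumannBasis (ζ i) q
  simp only [hre]
  exact hs k hk p (hsub hp)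
end

section
/- Let u : ℝ³ → ℂ (with coordinates (t,x,y)) be C^∞ on ℝ³ and satisfy the two-dimensional wave equation ∂²u/∂t² = ∂²u/∂x² + ∂²u/∂y² at every point (t,x,y) with x ≥ 0, together with the Dirichlet boundary condition u(t,0,y) = 0 for all t,y ∈ ℝ. For a,b,c ∈ ℂ with a² = b² + c² define g_{a,b,c} : ℝ³ → ℂ by g_{a,b,c}(t,x,y) = exp(a t + b x + c y) − exp(a t − b x + c y). Then for every compact set K ⊆ ℝ × [0,∞) × ℝ, every m ∈ ℕ, and every ε > 0, there exist r ∈ ℕ, triples (a_j,b_j,c_j) ∈ ℂ³ with a_j² = b_j² + c_j², and coefficients c'_1, …, c'_r ∈ ℂ such that for every k ≤ m, the k-th iterated derivative of u − Σ_{j=1}^r c'_j g_{a_j,b_j,c_j} has norm at most ε at every point of K. -/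
/-- Partial derivative in the first variable `t`. -/
noncomputable def d1 (u : ℝ × ℝ × ℝ → ℂ) : ℝ × ℝ × ℝ → ℂ :=
  fun p => deriv (fun s => u (s, p.2.1, p.2.2)) p.1

/-- Partial derivative in the second variable `x`. -/
noncomputable def d2 (u : ℝ × ℝ × ℝ → ℂ) : ℝ × ℝ × ℝ → ℂ :=
  fun p => deriv (fun s => u (p.1, s, p.2.2)) p.2.1

/-- Partial derivative in the third variable `y`. -/
noncomputable def d3 (u : ℝ × ℝ × ℝ → ℂ) : ℝ × ℝ × ℝ → ℂ :=
  fun p => deriv (fun s => u (p.1, p.2.1, s)) p.2.2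

/-- B-EPGP basis element for the 2D wave equation with Dirichlet boundary condition on
the plane `{x = 0}`. -/
noncomputable def waveDirichletBasis (a b c : ℂ) : ℝ × ℝ × ℝ → ℂ :=
  fun p => Complex.exp (a * (p.1 : ℂ) + b * (p.2.1 : ℂ) + c * (p.2.2 : ℂ)) -
    Complex.exp (a * (p.1 : ℂ) - b * (p.2.1 : ℂ) + c * (p.2.2 : ℂ))

section DirDeriv

variable {E F : Type*} [NormedAddCommGroup E] [NormedSpace ℝ E]
  [NormedAddCommGroup F] [NormedSpace ℝ F]

/-- The derivative of `f` in the fixed direction `e`. -/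
noncomputable def dirDeriv (e : E) (f : E → F) : E → F := fun p => fderiv ℝ f p e

theorem ContDiff.dirDeriv {f : E → F} (hf : ContDiff ℝ (⊤ : ℕ∞) f) (e : E) :
    ContDiff ℝ (⊤ : ℕ∞) (dirDeriv e f) :=
  (hf.fderiv_right (m := (⊤ : ℕ∞)) (by simp)).clm_apply contDiff_const

theorem ContDiff.differentiableAt_of_top {f : E → F} (hf : ContDiff ℝ (⊤ : ℕ∞) f) (p : E) :
    DifferentiableAt ℝ f p :=
  hf.differentiable (by simp) p

theorem dirDeriv_comm {f : E → F} (hf : ContDiff ℝ (⊤ : ℕ∞) f) (e e' : E) :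
    dirDeriv e (dirDeriv e' f) = dirDeriv e' (dirDeriv e f) := by
  have key : ∀ (a b p : E), dirDeriv a (dirDeriv b f) p = fderiv ℝ (fderiv ℝ f) p a b := by
    intro a b p
    have hd : DifferentiableAt ℝ (fderiv ℝ f) p :=
      (hf.fderiv_right (m := (⊤ : ℕ∞)) (by simp)).differentiableAt_of_top p
    change fderiv ℝ (fun q => fderiv ℝ f q b) p a = _
    rw [fderiv_clm_apply hd (differentiableAt_const b)]
    simp
  ext p
  rw [key, key]
  exact (hf.contDiffAt.isSymmSndFDerivAt
    (by simpa using WithTop.coe_le_coe.2 (le_top : (2 : ℕ∞) ≤ ⊤))) e e'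

theorem dirDeriv_add {f g : E → F} {p : E} (e : E) (hf : DifferentiableAt ℝ f p)
    (hg : DifferentiableAt ℝ g p) :
    dirDeriv e (fun q => f q + g q) p = dirDeriv e f p + dirDeriv e g p := by
  simp [dirDeriv, fderiv_fun_add hf hg]

theorem dirDeriv_sub {f g : E → F} {p : E} (e : E) (hf : DifferentiableAt ℝ f p)
    (hg : DifferentiableAt ℝ g p) :
    dirDeriv e (fun q => f q - g q) p = dirDeriv e f p - dirDeriv e g p := by
  simp [dirDeriv, fderiv_fun_sub hf hg]

theorem dirDeriv_mul {f g : E → ℝ} {p : E} (e : E) (hf : DifferentiableAt ℝ f p)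
    (hg : DifferentiableAt ℝ g p) :
    dirDeriv e (fun q => f q * g q) p = dirDeriv e f p * g p + f p * dirDeriv e g p := by
  simp [dirDeriv, fderiv_fun_mul hf hg]
  ring

theorem dirDeriv_sq {f : E → ℝ} {p : E} (e : E) (hf : DifferentiableAt ℝ f p) :
    dirDeriv e (fun q => f q ^ 2) p = 2 * f p * dirDeriv e f p := by
  simp_rw [sq]
  rw [dirDeriv_mul e hf hf]
  ring

end DirDeriv

section Energy

open MeasureTheory Set

/-- The squared positive part, as a continuously differentiable function. -/
theorem hasDerivAt_max_zero_sq (s : ℝ) :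
    HasDerivAt (fun s : ℝ => (max 0 s) ^ 2) (2 * max 0 s) s := by
  rcases lt_trichotomy s 0 with h | rfl | h
  · rw [max_eq_left h.le, mul_zero]
    refine (hasDerivAt_const s (0 : ℝ)).congr_of_eventuallyEq ?_
    filter_upwards [gt_mem_nhds h] with r hr
    simp [max_eq_left hr.le]
  · have : (fun s : ℝ => (max 0 s) ^ 2) =O[nhds 0] fun s : ℝ => s ^ 2 := by
      refine Asymptotics.isBigO_of_le _ fun s => ?_
      rw [norm_pow, norm_pow]
      gcongr
      rcases le_total 0 s with h | h <;> simp [h]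
    rw [hasDerivAt_iff_isLittleO_nhds_zero]
    simpa using this.trans_isLittleO (Asymptotics.isLittleO_pow_id one_lt_two)
  · rw [max_eq_right h.le]
    have := hasDerivAt_pow 2 s
    simp only [Nat.cast_ofNat, Nat.add_one_sub_one, pow_one] at this
    refine this.congr_of_eventuallyEq ?_
    filter_upwards [lt_mem_nhds h] with r hr
    simp [max_eq_right hr.le]

/-- The height `√(1 + x² + y²)` of the upper hyperboloid over the point `(x, y)`. -/
noncomputable def hyperboloidHeight (p : ℝ × ℝ × ℝ) : ℝ := √(1 + p.2.1 ^ 2 + p.2.2 ^ 2)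

theorem hyperboloidHeight_pos (p : ℝ × ℝ × ℝ) : 0 < hyperboloidHeight p :=
  Real.sqrt_pos.2 (by positivity)

theorem sq_hyperboloidHeight (p : ℝ × ℝ × ℝ) :
    hyperboloidHeight p ^ 2 = 1 + p.2.1 ^ 2 + p.2.2 ^ 2 :=
  Real.sq_sqrt (by positivity)

theorem continuous_hyperboloidHeight : Continuous hyperboloidHeight := by
  unfold hyperboloidHeight
  fun_prop

/-- The weight of the energy estimate, supported in a backward hyperboloid. -/
noncomputable def energyWeight (S : ℝ) (p : ℝ × ℝ × ℝ) : ℝ :=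
  (max 0 (S - p.1 - hyperboloidHeight p)) ^ 2

theorem hasFDerivAt_energyWeight (S : ℝ) (p : ℝ × ℝ × ℝ) :
    HasFDerivAt (energyWeight S)
      ((-2 * max 0 (S - p.1 - hyperboloidHeight p)) •
        (ContinuousLinearMap.fst ℝ ℝ (ℝ × ℝ) + (hyperboloidHeight p)⁻¹ •
          (p.2.1 • (ContinuousLinearMap.fst ℝ ℝ ℝ).comp (ContinuousLinearMap.snd ℝ ℝ (ℝ × ℝ)) +
          p.2.2 • (ContinuousLinearMap.snd ℝ ℝ ℝ).comp
            (ContinuousLinearMap.snd ℝ ℝ (ℝ × ℝ))))) p := by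
  have hpos : (1 + p.2.1 ^ 2 + p.2.2 ^ 2) ≠ 0 := by positivity
  have h1 : HasFDerivAt (fun p : ℝ × ℝ × ℝ => p.1) (ContinuousLinearMap.fst ℝ ℝ (ℝ × ℝ)) p :=
    hasFDerivAt_fst
  have h2 : HasFDerivAt (fun p : ℝ × ℝ × ℝ => p.2.1)
      ((ContinuousLinearMap.fst ℝ ℝ ℝ).comp (ContinuousLinearMap.snd ℝ ℝ (ℝ × ℝ))) p :=
    ((ContinuousLinearMap.fst ℝ ℝ ℝ).comp (ContinuousLinearMap.snd ℝ ℝ (ℝ × ℝ))).hasFDerivAt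
  have h3 : HasFDerivAt (fun p : ℝ × ℝ × ℝ => p.2.2)
      ((ContinuousLinearMap.snd ℝ ℝ ℝ).comp (ContinuousLinearMap.snd ℝ ℝ (ℝ × ℝ))) p :=
    ((ContinuousLinearMap.snd ℝ ℝ ℝ).comp (ContinuousLinearMap.snd ℝ ℝ (ℝ × ℝ))).hasFDerivAt
  have hq := (((hasFDerivAt_const (1 : ℝ) p).add (h2.pow 2)).add (h3.pow 2)).sqrt hpos
  have := (hasDerivAt_max_zero_sq (S - p.1 - hyperboloidHeight p)).comp_hasFDerivAt p
    (((hasFDerivAt_const S p).sub h1).sub hq)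
  refine this.congr_fderiv ?_
  have hq0 : hyperboloidHeight p ≠ 0 := (hyperboloidHeight_pos p).ne'
  ext <;> simp [hyperboloidHeight] at hq0 ⊢ <;> field_simp <;> simp

theorem dirDeriv_energyWeight (S : ℝ) (p : ℝ × ℝ × ℝ) (e : ℝ × ℝ × ℝ) :
    dirDeriv e (energyWeight S) p = -2 * max 0 (S - p.1 - hyperboloidHeight p) *
      (e.1 + (p.2.1 * e.2.1 + p.2.2 * e.2.2) / hyperboloidHeight p) := by
  simp [dirDeriv, (hasFDerivAt_energyWeight S p).fderiv]
  ring

/-- The coordinate isomorphism from `Fin 3 → ℝ` to the triple product. -/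
noncomputable def tripleCLM : (Fin 3 → ℝ) →L[ℝ] ℝ × ℝ × ℝ :=
  (ContinuousLinearMap.proj 0).prod
    ((ContinuousLinearMap.proj 1).prod (ContinuousLinearMap.proj 2))

@[simp]
theorem tripleCLM_apply (p : Fin 3 → ℝ) : tripleCLM p = (p 0, p 1, p 2) := rfl

/-- The divergence theorem on a box of `ℝ × ℝ × ℝ`, for a vector field which vanishes on the
boundary of the box. If the divergence is nonpositive, then it is zero. -/
theorem divergence_eq_zero_of_nonpos {G : Fin 3 → ℝ × ℝ × ℝ → ℝ} {S : ℝ} (hS : 0 < S)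
    (hG : ∀ i, Differentiable ℝ (G i))
    {δ : ℝ × ℝ × ℝ → ℝ} (hδ : Continuous δ)
    (hdiv : ∀ p, dirDeriv (1, 0, 0) (G 0) p + dirDeriv (0, 1, 0) (G 1) p +
      dirDeriv (0, 0, 1) (G 2) p = δ p)
    (hnonpos : ∀ p, δ p ≤ 0)
    (h0 : ∀ x y, G 0 (0, x, y) = 0) (h0' : ∀ x y, G 0 (S, x, y) = 0)
    (h1 : ∀ t y, 0 ≤ t → G 1 (t, -S, y) = 0) (h1' : ∀ t y, 0 ≤ t → G 1 (t, S, y) = 0)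
    (h2 : ∀ t x, 0 ≤ t → G 2 (t, x, -S) = 0) (h2' : ∀ t x, 0 ≤ t → G 2 (t, x, S) = 0) :
    ∀ t x y, t ∈ Icc 0 S → x ∈ Icc (-S) S → y ∈ Icc (-S) S → δ (t, x, y) = 0 := by
  set a : Fin 3 → ℝ := ![0, -S, -S] with ha
  set b : Fin 3 → ℝ := ![S, S, S] with hb
  have hlt : ∀ i, a i < b i := by
    intro i
    fin_cases i <;> simp [a, b] <;> linarith
  have hsum : ∀ p : Fin 3 → ℝ, ∑ i, ((fderiv ℝ (G i) (tripleCLM p)).comp tripleCLM)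
      (Pi.single i 1) = δ (tripleCLM p) := by
    intro p
    rw [← hdiv, Fin.sum_univ_three]
    simp [dirDeriv]
  have hcont : Continuous fun p : Fin 3 → ℝ => δ (tripleCLM p) := by fun_prop
  have key := integral_divergence_of_hasFDerivAt_off_countable' a b (fun i => (hlt i).le)
    (fun i p => G i (tripleCLM p))
    (fun i p => (fderiv ℝ (G i) (tripleCLM p)).comp tripleCLM) ∅ countable_empty
    (fun i => ((hG i).continuous.comp tripleCLM.continuous).continuousOn)
    (fun p _ i => (hG i _).hasFDerivAt.comp p tripleCLM.hasFDerivAt)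
    (by
      simp_rw [hsum]
      exact hcont.continuousOn.integrableOn_compact isCompact_Icc)
  simp_rw [hsum] at key
  have hfaces : ∀ (i : Fin 3) (c : ℝ), c = a i ∨ c = b i →
      ∫ x in Icc (a ∘ i.succAbove) (b ∘ i.succAbove), G i (tripleCLM (i.insertNth c x)) = 0 := by
    intro i c hc
    refine setIntegral_eq_zero_of_forall_eq_zero fun x hx => ?_
    fin_cases i
    · rcases hc with rfl | rfl
      · simpa [a] using h0 _ _
      · simpa [b] using h0' _ _
    · have hx0 : 0 ≤ x 0 := by simpa [a] using hx.1 0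
      change G 1 (x 0, c, x 1) = 0
      rcases hc with rfl | rfl
      · exact h1 _ _ hx0
      · exact h1' _ _ hx0
    · have hx0 : 0 ≤ x 0 := by simpa [a] using hx.1 0
      change G 2 (x 0, x 1, c) = 0
      rcases hc with rfl | rfl
      · exact h2 _ _ hx0
      · exact h2' _ _ hx0
  rw [Finset.sum_eq_zero fun i _ => by
    rw [hfaces i _ (Or.inr rfl), hfaces i _ (Or.inl rfl), sub_zero]] at key
  have hneg : ∫ p in Icc a b, (-fun p => δ (tripleCLM p)) p = 0 := by
    simp_rw [Pi.neg_apply]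
    rw [integral_neg, key, neg_zero]
  rw [setIntegral_eq_zero_iff_of_nonneg_ae
    (Filter.Eventually.of_forall fun p => by simpa using hnonpos _)
    (hcont.neg.continuousOn.integrableOn_compact isCompact_Icc)] at hneg
  have hclos : Icc a b ⊆ closure (interior (Icc a b)) := by
    rw [(convex_Icc (𝕜 := ℝ) a b).closure_interior_eq_closure_of_nonempty_interior]
    · exact subset_closure
    · rw [← pi_univ_Icc, interior_pi_set finite_univ]
      simp_rw [interior_Icc]
      exact ⟨fun i => (a i + b i) / 2, fun i _ => ⟨by linarith [hlt i], by linarith [hlt i]⟩⟩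
  have heq := Measure.eqOn_of_ae_eq hneg hcont.neg.continuousOn continuousOn_const hclos
  intro t x y ht hx hy
  have hmem : (![t, x, y] : Fin 3 → ℝ) ∈ Icc a b := by
    constructor <;> intro i <;> fin_cases i <;> simp [a, b, ht.1, ht.2, hx.1, hx.2, hy.1, hy.2]
  simpa using heq hmem

/-- The energy flux of a solution with vanishing Cauchy data in a ball. -/
theorem wave_dirDeriv_time_eq_zero {w : ℝ × ℝ × ℝ → ℝ} (hw : ContDiff ℝ (⊤ : ℕ∞) w)
    (hwave : ∀ p, dirDeriv (1, 0, 0) (dirDeriv (1, 0, 0) w) p =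
      dirDeriv (0, 1, 0) (dirDeriv (0, 1, 0) w) p + dirDeriv (0, 0, 1) (dirDeriv (0, 0, 1) w) p)
    {S : ℝ} (hS : 0 < S) (h0 : ∀ x y : ℝ, x ^ 2 + y ^ 2 < S ^ 2 → w (0, x, y) = 0)
    (h1 : ∀ x y : ℝ, x ^ 2 + y ^ 2 < S ^ 2 → dirDeriv (1, 0, 0) w (0, x, y) = 0)
    {p : ℝ × ℝ × ℝ} (hp0 : 0 ≤ p.1) (hp : hyperboloidHeight p + p.1 < S) :
    dirDeriv (1, 0, 0) w p = 0 := by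
  set wt := dirDeriv (1, 0, 0) w with hwt
  set wx := dirDeriv (0, 1, 0) w with hwx
  set wy := dirDeriv (0, 0, 1) w with hwy
  have ct : ContDiff ℝ (⊤ : ℕ∞) wt := hw.dirDeriv _
  have cx : ContDiff ℝ (⊤ : ℕ∞) wx := hw.dirDeriv _
  have cy : ContDiff ℝ (⊤ : ℕ∞) wy := hw.dirDeriv _
  have dt := ct.differentiable (by simp)
  have dx := cx.differentiable (by simp)
  have dy := cy.differentiable (by simp)
  have dφ : Differentiable ℝ (energyWeight S) :=
    fun q => (hasFDerivAt_energyWeight S q).differentiableAt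
  have hsupp : ∀ q : ℝ × ℝ × ℝ, S ≤ hyperboloidHeight q + q.1 → energyWeight S q = 0 := by
    intro q hq
    simp [energyWeight, max_eq_left (show S - q.1 - hyperboloidHeight q ≤ 0 by linarith)]
  have hx_le : ∀ q : ℝ × ℝ × ℝ, |q.2.1| ≤ hyperboloidHeight q := fun q =>
    Real.abs_le_sqrt (by nlinarith)
  have hy_le : ∀ q : ℝ × ℝ × ℝ, |q.2.2| ≤ hyperboloidHeight q := fun q =>
    Real.abs_le_sqrt (by nlinarith)
  have hspace : ∀ x y : ℝ, x ^ 2 + y ^ 2 < S ^ 2 →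
      wx (0, x, y) = 0 ∧ wy (0, x, y) = 0 := by
    intro x y hxy
    have hopen : ∀ᶠ q : ℝ × ℝ in nhds (x, y), w (0, q) = 0 := by
      have : IsOpen {q : ℝ × ℝ | q.1 ^ 2 + q.2 ^ 2 < S ^ 2} :=
        isOpen_lt (by fun_prop) (by fun_prop)
      filter_upwards [this.mem_nhds hxy] with q hq using h0 q.1 q.2 hq
    have hcomp : HasFDerivAt (fun q : ℝ × ℝ => w (0, q))
        ((fderiv ℝ w (0, x, y)).comp (ContinuousLinearMap.inr ℝ ℝ (ℝ × ℝ))) (x, y) := by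
      have hd := (hw.differentiableAt_of_top (0, x, y)).hasFDerivAt
      exact HasFDerivAt.comp (f := fun q : ℝ × ℝ => ((0 : ℝ), q)) (x, y) hd
        (ContinuousLinearMap.inr ℝ ℝ (ℝ × ℝ)).hasFDerivAt
    have hzero := hcomp.unique ((hasFDerivAt_const (0 : ℝ) (x, y)).congr_of_eventuallyEq hopen)
    constructor
    · simpa [hwx, dirDeriv] using congrArg (fun T => T (1, 0)) hzero
    · simpa [hwy, dirDeriv] using congrArg (fun T => T (0, 1)) hzero
  let G : Fin 3 → ℝ × ℝ × ℝ → ℝ := ![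
    fun q => energyWeight S q * (wt q ^ 2 + wx q ^ 2 + wy q ^ 2),
    fun q => energyWeight S q * ((-2 * wt q) * wx q),
    fun q => energyWeight S q * ((-2 * wt q) * wy q)]
  let δ : ℝ × ℝ × ℝ → ℝ := fun q => -2 * max 0 (S - q.1 - hyperboloidHeight q) *
    (wt q ^ 2 + wx q ^ 2 + wy q ^ 2 -
      2 * wt q * (q.2.1 * wx q + q.2.2 * wy q) / hyperboloidHeight q)
  have hδ : Continuous δ := by
    have := continuous_hyperboloidHeight
    have := ct.continuous
    have := cx.continuous
    have := cy.continuous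
    refine Continuous.mul (by fun_prop) (Continuous.sub (by fun_prop) ?_)
    exact Continuous.div (by fun_prop) (by fun_prop) fun q => (hyperboloidHeight_pos q).ne'
  have hsquares : ∀ q : ℝ × ℝ × ℝ, wt q ^ 2 + wx q ^ 2 + wy q ^ 2 -
      2 * wt q * (q.2.1 * wx q + q.2.2 * wy q) / hyperboloidHeight q =
      (wx q - wt q * q.2.1 / hyperboloidHeight q) ^ 2 +
      (wy q - wt q * q.2.2 / hyperboloidHeight q) ^ 2 + (wt q / hyperboloidHeight q) ^ 2 := by
    intro q
    have hq := sq_hyperboloidHeight q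
    have hq0 := (hyperboloidHeight_pos q).ne'
    field_simp
    linear_combination (wt q ^ 2) * hq
  have hdiv : ∀ q, dirDeriv (1, 0, 0) (G 0) q + dirDeriv (0, 1, 0) (G 1) q +
      dirDeriv (0, 0, 1) (G 2) q = δ q := by
    intro q
    have hxt : dirDeriv (1, 0, 0) wx = dirDeriv (0, 1, 0) wt := dirDeriv_comm hw _ _
    have hyt : dirDeriv (1, 0, 0) wy = dirDeriv (0, 0, 1) wt := dirDeriv_comm hw _ _
    have e0 : dirDeriv (1, 0, 0) (G 0) q =
        dirDeriv (1, 0, 0) (energyWeight S) q * (wt q ^ 2 + wx q ^ 2 + wy q ^ 2) +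
        energyWeight S q * (2 * wt q * dirDeriv (1, 0, 0) wt q +
          2 * wx q * dirDeriv (0, 1, 0) wt q + 2 * wy q * dirDeriv (0, 0, 1) wt q) := by
      change dirDeriv (1, 0, 0)
        (fun q => energyWeight S q * (wt q ^ 2 + wx q ^ 2 + wy q ^ 2)) q = _
      rw [dirDeriv_mul _ (dφ q) (by fun_prop), dirDeriv_add _ (by fun_prop) (by fun_prop),
        dirDeriv_add _ (by fun_prop) (by fun_prop), dirDeriv_sq _ (dt q), dirDeriv_sq _ (dx q),
        dirDeriv_sq _ (dy q), hxt, hyt]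
    have hflux : ∀ (e : ℝ × ℝ × ℝ) (z : ℝ × ℝ × ℝ → ℝ), Differentiable ℝ z →
        dirDeriv e (fun q => energyWeight S q * ((-2 * wt q) * z q)) q =
          dirDeriv e (energyWeight S) q * (-2 * wt q * z q) +
          energyWeight S q * (-2 * dirDeriv e wt q * z q + -2 * wt q * dirDeriv e z q) := by
      intro e z hz
      rw [dirDeriv_mul _ (dφ q) (by fun_prop), dirDeriv_mul _ (by fun_prop) (hz q),
        dirDeriv_mul _ (by fun_prop) (dt q)]
      simp [dirDeriv]
    have e1 := hflux (0, 1, 0) wx dx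
    have e2 := hflux (0, 0, 1) wy dy
    change _ + dirDeriv (0, 1, 0) (fun q => energyWeight S q * ((-2 * wt q) * wx q)) q +
      dirDeriv (0, 0, 1) (fun q => energyWeight S q * ((-2 * wt q) * wy q)) q = _
    rw [e0, e1, e2, dirDeriv_energyWeight, dirDeriv_energyWeight, dirDeriv_energyWeight]
    have := hwave q
    simp only [δ]
    linear_combination (2 * energyWeight S q * wt q) * this
  have hG : ∀ i, Differentiable ℝ (G i) := by
    intro i
    fin_cases i <;> simp [G] <;> fun_prop
  have hnonpos : ∀ q, δ q ≤ 0 := by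
    intro q
    simp only [δ, hsquares]
    have : 0 ≤ max 0 (S - q.1 - hyperboloidHeight q) := le_max_left _ _
    have h2 : 0 ≤ (wx q - wt q * q.2.1 / hyperboloidHeight q) ^ 2 +
      (wy q - wt q * q.2.2 / hyperboloidHeight q) ^ 2 + (wt q / hyperboloidHeight q) ^ 2 := by
      positivity
    nlinarith [mul_nonneg this h2]
  have hinit : ∀ x y, G 0 (0, x, y) = 0 := by
    intro x y
    change energyWeight S (0, x, y) * (wt (0, x, y) ^ 2 + wx (0, x, y) ^ 2 + wy (0, x, y) ^ 2) = 0
    by_cases hxy : x ^ 2 + y ^ 2 < S ^ 2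
    · rw [h1 x y hxy, (hspace x y hxy).1, (hspace x y hxy).2]
      simp
    · rw [hsupp, zero_mul]
      have := Real.le_sqrt_of_sq_le (show S ^ 2 ≤ 1 + x ^ 2 + y ^ 2 by linarith)
      simpa [hyperboloidHeight] using this
  have hzero := divergence_eq_zero_of_nonpos hS hG hδ hdiv hnonpos hinit
    (fun x y => by
      change energyWeight S (S, x, y) * _ = 0
      rw [hsupp _ (by linarith [hyperboloidHeight_pos (S, x, y)]), zero_mul])
    (fun t y ht => by
      change energyWeight S (t, -S, y) * _ = 0
      rw [hsupp, zero_mul]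
      have := (abs_le.1 (hx_le (t, -S, y))).1
      simp only at this ⊢
      linarith)
    (fun t y ht => by
      change energyWeight S (t, S, y) * _ = 0
      rw [hsupp, zero_mul]
      have := (abs_le.1 (hx_le (t, S, y))).2
      simp only at this ⊢
      linarith)
    (fun t x ht => by
      change energyWeight S (t, x, -S) * _ = 0
      rw [hsupp, zero_mul]
      have := (abs_le.1 (hy_le (t, x, -S))).1
      simp only at this ⊢
      linarith)
    (fun t x ht => by
      change energyWeight S (t, x, S) * _ = 0
      rw [hsupp, zero_mul]
      have := (abs_le.1 (hy_le (t, x, S))).2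
      simp only at this ⊢
      linarith)
  have hq := hyperboloidHeight_pos p
  have hpx := abs_le.1 (hx_le p)
  have hpy := abs_le.1 (hy_le p)
  have hδp : δ p = 0 := hzero p.1 p.2.1 p.2.2 ⟨hp0, by linarith⟩
    ⟨by linarith, by linarith⟩ ⟨by linarith, by linarith⟩
  simp only [δ, hsquares] at hδp
  have hm : 0 < max 0 (S - p.1 - hyperboloidHeight p) := lt_max_of_lt_right (by linarith)
  have hsq : (wx p - wt p * p.2.1 / hyperboloidHeight p) ^ 2 +
      (wy p - wt p * p.2.2 / hyperboloidHeight p) ^ 2 + (wt p / hyperboloidHeight p) ^ 2 = 0 := by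
    rcases mul_eq_zero.1 hδp with h | h
    · linarith
    · exact h
  have hlast : (wt p / hyperboloidHeight p) ^ 2 = 0 := by
    nlinarith [sq_nonneg (wx p - wt p * p.2.1 / hyperboloidHeight p),
      sq_nonneg (wy p - wt p * p.2.2 / hyperboloidHeight p),
      sq_nonneg (wt p / hyperboloidHeight p)]
  simpa [hq.ne'] using hlast

end Energy

section Uniqueness

open Set

variable {E E' F F' : Type*} [NormedAddCommGroup E] [NormedSpace ℝ E]
  [NormedAddCommGroup E'] [NormedSpace ℝ E']
  [NormedAddCommGroup F] [NormedSpace ℝ F] [NormedAddCommGroup F'] [NormedSpace ℝ F']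

theorem dirDeriv_clm_comp (T : F →L[ℝ] F') {f : E → F} (hf : Differentiable ℝ f) (e : E) :
    dirDeriv e (fun q => T (f q)) = fun p => T (dirDeriv e f p) := by
  ext p
  have := T.hasFDerivAt.comp p (hf p).hasFDerivAt
  simp only [Function.comp_def] at this
  simp [dirDeriv, this.fderiv]

theorem dirDeriv_comp_clm (T : E →L[ℝ] E') {f : E' → F} (hf : Differentiable ℝ f) (e : E) :
    dirDeriv e (fun q => f (T q)) = fun p => dirDeriv (T e) f (T p) := by
  ext p
  have := (hf (T p)).hasFDerivAt.comp p T.hasFDerivAt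
  simp only [Function.comp_def] at this
  simp [dirDeriv, this.fderiv]

/-- A smooth function on space-time solving the two-dimensional wave equation everywhere. -/
structure IsWave {F : Type*} [NormedAddCommGroup F] [NormedSpace ℝ F]
    (w : ℝ × ℝ × ℝ → F) : Prop where
  contDiff : ContDiff ℝ (⊤ : ℕ∞) w
  wave : ∀ p, dirDeriv (1, 0, 0) (dirDeriv (1, 0, 0) w) p =
    dirDeriv (0, 1, 0) (dirDeriv (0, 1, 0) w) p + dirDeriv (0, 0, 1) (dirDeriv (0, 0, 1) w) p

theorem IsWave.clm_comp {w : ℝ × ℝ × ℝ → F} (hw : IsWave w) (T : F →L[ℝ] F') :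
    IsWave fun q => T (w q) where
  contDiff := T.contDiff.comp hw.contDiff
  wave p := by
    have h : ∀ e, dirDeriv e (dirDeriv e fun q => T (w q)) p = T (dirDeriv e (dirDeriv e w) p) := by
      intro e
      rw [dirDeriv_clm_comp T (hw.contDiff.differentiable (by simp)),
        dirDeriv_clm_comp T ((hw.contDiff.dirDeriv e).differentiable (by simp))]
    rw [h, h, h, hw.wave, map_add]

theorem IsWave.sub {w z : ℝ × ℝ × ℝ → F} (hw : IsWave w) (hz : IsWave z) :
    IsWave fun q => w q - z q where
  contDiff := hw.contDiff.sub hz.contDiff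
  wave p := by
    have h : ∀ e, dirDeriv e (dirDeriv e fun q => w q - z q) p =
        dirDeriv e (dirDeriv e w) p - dirDeriv e (dirDeriv e z) p := by
      intro e
      have : dirDeriv e (fun q => w q - z q) = fun q => dirDeriv e w q - dirDeriv e z q :=
        funext fun q => dirDeriv_sub e (hw.contDiff.differentiableAt_of_top q)
          (hz.contDiff.differentiableAt_of_top q)
      rw [this, dirDeriv_sub e ((hw.contDiff.dirDeriv e).differentiableAt_of_top p)
        ((hz.contDiff.dirDeriv e).differentiableAt_of_top p)]
    rw [h, h, h, hw.wave, hz.wave]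
    abel

/-- Time reversal on space-time. -/
noncomputable def timeReversal : ℝ × ℝ × ℝ →L[ℝ] ℝ × ℝ × ℝ :=
  (-ContinuousLinearMap.fst ℝ ℝ (ℝ × ℝ)).prod (ContinuousLinearMap.snd ℝ ℝ (ℝ × ℝ))

@[simp]
theorem timeReversal_apply (p : ℝ × ℝ × ℝ) : timeReversal p = (-p.1, p.2) := rfl

theorem dirDeriv_neg_dir (e : E) (f : E → F) : dirDeriv (-e) f = fun p => -dirDeriv e f p := by
  ext p
  simp [dirDeriv]

theorem dirDeriv_comp_timeReversal {w : ℝ × ℝ × ℝ → F} (hw : Differentiable ℝ w) :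
    dirDeriv (1, 0, 0) (fun q => w (timeReversal q)) =
      fun p => -dirDeriv (1, 0, 0) w (timeReversal p) := by
  rw [dirDeriv_comp_clm _ hw]
  have : timeReversal (1, 0, 0) = -(1, 0, 0) := by simp
  simp_rw [this, dirDeriv_neg_dir]

theorem IsWave.comp_timeReversal {w : ℝ × ℝ × ℝ → F} (hw : IsWave w) :
    IsWave fun q => w (timeReversal q) where
  contDiff := hw.contDiff.comp timeReversal.contDiff
  wave p := by
    have d : ∀ e, Differentiable ℝ (dirDeriv e w) := fun e =>
      (hw.contDiff.dirDeriv e).differentiable (by simp)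
    have h : ∀ e, timeReversal e = e → dirDeriv e (dirDeriv e fun q => w (timeReversal q)) p =
        dirDeriv e (dirDeriv e w) (timeReversal p) := by
      intro e he
      rw [dirDeriv_comp_clm _ (hw.contDiff.differentiable (by simp)), he,
        dirDeriv_comp_clm _ (d e), he]
    rw [h (0, 1, 0) (by simp), h (0, 0, 1) (by simp), ← hw.wave,
      dirDeriv_comp_timeReversal (hw.contDiff.differentiable (by simp))]
    have := congrFun (dirDeriv_comp_timeReversal (d (1, 0, 0))) p
    have hneg := congrFun (dirDeriv_clm_comp (-ContinuousLinearMap.id ℝ F)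
      ((d (1, 0, 0)).comp timeReversal.differentiable) (1, 0, 0)) p
    simp only [Function.comp_def, neg_apply,
      ContinuousLinearMap.id_apply] at hneg
    rw [hneg, this, neg_neg]

theorem wave_eq_zero_of_nonneg_time {w : ℝ × ℝ × ℝ → ℝ} (hw : IsWave w)
    {S : ℝ} (hS : 0 < S) (h0 : ∀ x y : ℝ, x ^ 2 + y ^ 2 < S ^ 2 → w (0, x, y) = 0)
    (h1 : ∀ x y : ℝ, x ^ 2 + y ^ 2 < S ^ 2 → dirDeriv (1, 0, 0) w (0, x, y) = 0)
    {p : ℝ × ℝ × ℝ} (hp0 : 0 ≤ p.1) (hp : hyperboloidHeight p + p.1 < S) : w p = 0 := by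
  obtain ⟨t, x, y⟩ := p
  have hline : ∀ s : ℝ, HasDerivAt (fun s : ℝ => w (s, x, y))
      (dirDeriv (1, 0, 0) w (s, x, y)) s := fun s => by
    have h := (hw.contDiff.differentiableAt_of_top (s, x, y)).hasFDerivAt
    have h' : HasDerivAt (fun s : ℝ => (s, x, y)) ((1 : ℝ), (0 : ℝ), (0 : ℝ)) s :=
      (hasDerivAt_id s).prodMk (hasDerivAt_const s (x, y))
    exact h.comp_hasDerivAt s h'
  have hconst := constant_of_has_deriv_right_zero (a := 0) (b := t)
    (fun s _ => (hline s).continuousAt.continuousWithinAt)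
    (fun s hs => by
      have := (hline s).hasDerivWithinAt (s := Ici s)
      rwa [wave_dirDeriv_time_eq_zero hw.contDiff hw.wave hS h0 h1 hs.1 (lt_trans
        (by simpa [hyperboloidHeight] using hs.2) hp)] at this)
  rw [hconst t ⟨hp0, le_rfl⟩]
  have hlt : hyperboloidHeight (t, x, y) < S := by
    have : (0 : ℝ) ≤ t := hp0
    linarith [show hyperboloidHeight (t, x, y) + t < S from hp]
  refine h0 x y ?_
  have h2 := sq_hyperboloidHeight (t, x, y)
  have h3 := hyperboloidHeight_pos (t, x, y)
  simp only at h2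
  nlinarith

/-- Local uniqueness for the Cauchy problem of the wave equation. -/
theorem IsWave.eq_zero_of_cauchy {w : ℝ × ℝ × ℝ → ℂ} (hw : IsWave w)
    {S : ℝ} (hS : 0 < S) (h0 : ∀ x y : ℝ, x ^ 2 + y ^ 2 < S ^ 2 → w (0, x, y) = 0)
    (h1 : ∀ x y : ℝ, x ^ 2 + y ^ 2 < S ^ 2 → dirDeriv (1, 0, 0) w (0, x, y) = 0)
    {p : ℝ × ℝ × ℝ} (hp : hyperboloidHeight p + |p.1| < S) : w p = 0 := by
  have hreal : ∀ (T : ℂ →L[ℝ] ℝ) {q : ℝ × ℝ × ℝ} {z : ℝ × ℝ × ℝ → ℂ}, IsWave z →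
      (∀ x y : ℝ, x ^ 2 + y ^ 2 < S ^ 2 → z (0, x, y) = 0) →
      (∀ x y : ℝ, x ^ 2 + y ^ 2 < S ^ 2 → dirDeriv (1, 0, 0) z (0, x, y) = 0) →
      0 ≤ q.1 → hyperboloidHeight q + q.1 < S → T (z q) = 0 := by
    intro T q z hz hz0 hz1 hq0 hq
    refine wave_eq_zero_of_nonneg_time (hz.clm_comp T) hS (fun x y hxy => ?_) (fun x y hxy => ?_)
      hq0 hq
    · rw [hz0 x y hxy, map_zero]
    · rw [dirDeriv_clm_comp T (hz.contDiff.differentiable (by simp))]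
      simp only [hz1 x y hxy, map_zero]
  have hcomplex : ∀ {q : ℝ × ℝ × ℝ} {z : ℝ × ℝ × ℝ → ℂ}, IsWave z →
      (∀ x y : ℝ, x ^ 2 + y ^ 2 < S ^ 2 → z (0, x, y) = 0) →
      (∀ x y : ℝ, x ^ 2 + y ^ 2 < S ^ 2 → dirDeriv (1, 0, 0) z (0, x, y) = 0) →
      0 ≤ q.1 → hyperboloidHeight q + q.1 < S → z q = 0 := fun hz hz0 hz1 hq0 hq =>
    Complex.ext (hreal Complex.reCLM hz hz0 hz1 hq0 hq) (hreal Complex.imCLM hz hz0 hz1 hq0 hq)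
  rcases le_total 0 p.1 with hpos | hneg
  · exact hcomplex hw h0 h1 hpos (by rwa [abs_of_nonneg hpos] at hp)
  · have := hcomplex (q := timeReversal p) hw.comp_timeReversal
      (fun x y hxy => by simpa using h0 x y hxy)
      (fun x y hxy => by
        rw [dirDeriv_comp_timeReversal (hw.contDiff.differentiable (by simp))]
        simpa using h1 x y hxy)
      (by simpa using hneg)
      (by rw [abs_of_nonpos hneg] at hp; simpa [hyperboloidHeight] using hp)
    simpa using this

end Uniqueness

section Reflection

open Set

/-- The reflection of space-time in the plane `{x = 0}`. -/
noncomputable def reflectX : ℝ × ℝ × ℝ →L[ℝ] ℝ × ℝ × ℝ :=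
  (ContinuousLinearMap.fst ℝ ℝ (ℝ × ℝ)).prod
    ((-(ContinuousLinearMap.fst ℝ ℝ ℝ).comp (ContinuousLinearMap.snd ℝ ℝ (ℝ × ℝ))).prod
      ((ContinuousLinearMap.snd ℝ ℝ ℝ).comp (ContinuousLinearMap.snd ℝ ℝ (ℝ × ℝ))))

@[simp]
theorem reflectX_apply (p : ℝ × ℝ × ℝ) : reflectX p = (p.1, -p.2.1, p.2.2) := rfl

/-- The extension of `u` from `{x ≥ 0}` by reflection, even for `s = 1` and odd for `s = -1`. -/
noncomputable def reflectExtend (s : ℝ) (u : ℝ × ℝ × ℝ → ℂ) (p : ℝ × ℝ × ℝ) : ℂ :=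
  if 0 ≤ p.2.1 then u p else s • u (reflectX p)

/-- Smooth solutions of the wave equation on `{x ≥ 0}`, with Neumann condition for `s = 1` and
Dirichlet condition for `s = -1`. -/
structure IsHalfWave (s : ℝ) (u : ℝ × ℝ × ℝ → ℂ) : Prop where
  contDiff : ContDiff ℝ (⊤ : ℕ∞) u
  wave : ∀ p : ℝ × ℝ × ℝ, 0 ≤ p.2.1 → dirDeriv (1, 0, 0) (dirDeriv (1, 0, 0) u) p =
    dirDeriv (0, 1, 0) (dirDeriv (0, 1, 0) u) p + dirDeriv (0, 0, 1) (dirDeriv (0, 0, 1) u) p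
  boundary : s = -1 ∧ (∀ t y : ℝ, u (t, 0, y) = 0) ∨
    s = 1 ∧ ∀ t y : ℝ, dirDeriv (0, 1, 0) u (t, 0, y) = 0

theorem dirDeriv_eq_zero_of_nonneg {Q : ℝ × ℝ × ℝ → ℂ} (hQ : Differentiable ℝ Q)
    (h : ∀ p : ℝ × ℝ × ℝ, 0 ≤ p.2.1 → Q p = 0) (e : ℝ × ℝ × ℝ) {p : ℝ × ℝ × ℝ}
    (hp : 0 ≤ p.2.1) : dirDeriv e Q p = 0 := by
  have hconv : Convex ℝ {q : ℝ × ℝ × ℝ | 0 ≤ q.2.1} :=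
    convex_halfSpace_ge (f := fun q : ℝ × ℝ × ℝ => q.2.1)
      ⟨fun _ _ => rfl, fun _ _ => rfl⟩ 0
  have hint : (interior {q : ℝ × ℝ × ℝ | 0 ≤ q.2.1}).Nonempty := by
    refine ⟨(0, 1, 0), mem_interior.2 ⟨{q | 0 < q.2.1}, fun q (hq : 0 < q.2.1) =>
      show 0 ≤ q.2.1 from hq.le, ?_, ?_⟩⟩
    · exact isOpen_lt (by fun_prop) (by fun_prop)
    · simp
  have h1 := (hQ p).hasFDerivAt.hasFDerivWithinAt (s := {q : ℝ × ℝ × ℝ | 0 ≤ q.2.1})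
  have h2 : HasFDerivWithinAt Q (0 : ℝ × ℝ × ℝ →L[ℝ] ℂ) {q : ℝ × ℝ × ℝ | 0 ≤ q.2.1} p :=
    (hasFDerivWithinAt_const (0 : ℂ) p _).congr (fun q hq => h q hq) (h p hp)
  have := (uniqueDiffOn_convex hconv hint p hp).eq h1 h2
  simp [dirDeriv, this]

theorem dirDeriv_eq_zero_of_boundary {Q : ℝ × ℝ × ℝ → ℂ} (hQ : Differentiable ℝ Q)
    (h : ∀ t y : ℝ, Q (t, 0, y) = 0) {e : ℝ × ℝ × ℝ} (he : e.2.1 = 0) (t y : ℝ) :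
    dirDeriv e Q (t, 0, y) = 0 := by
  let J : ℝ × ℝ →L[ℝ] ℝ × ℝ × ℝ := (ContinuousLinearMap.fst ℝ ℝ ℝ).prod
    ((0 : ℝ × ℝ →L[ℝ] ℝ).prod (ContinuousLinearMap.snd ℝ ℝ ℝ))
  have h1 := congrFun (dirDeriv_comp_clm J hQ (e.1, e.2.2)) (t, y)
  have h2 : (fun q => Q (J q)) = fun _ => 0 := funext fun q => h q.1 q.2
  have h3 : J (e.1, e.2.2) = e := by
    simp [J, ← he]
  rw [h2, h3] at h1
  simpa [dirDeriv, J] using h1.symm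

theorem IsHalfWave.wave_dirDeriv {s : ℝ} {u : ℝ × ℝ × ℝ → ℂ} (hu : IsHalfWave s u)
    (e : ℝ × ℝ × ℝ) {p : ℝ × ℝ × ℝ} (hp : 0 ≤ p.2.1) :
    dirDeriv (1, 0, 0) (dirDeriv (1, 0, 0) (dirDeriv e u)) p =
      dirDeriv (0, 1, 0) (dirDeriv (0, 1, 0) (dirDeriv e u)) p +
      dirDeriv (0, 0, 1) (dirDeriv (0, 0, 1) (dirDeriv e u)) p := by
  have hc := hu.contDiff
  have hcomm : ∀ a, dirDeriv a (dirDeriv a (dirDeriv e u)) =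
      dirDeriv e (dirDeriv a (dirDeriv a u)) := fun a => by
    rw [dirDeriv_comm hc a e, dirDeriv_comm (hc.dirDeriv a) a e]
  have hd : ∀ a q, DifferentiableAt ℝ (dirDeriv a (dirDeriv a u)) q := fun a q =>
    ((hc.dirDeriv a).dirDeriv a).differentiableAt_of_top q
  have hzero := dirDeriv_eq_zero_of_nonneg
    (Q := fun q => dirDeriv (1, 0, 0) (dirDeriv (1, 0, 0) u) q -
      (dirDeriv (0, 1, 0) (dirDeriv (0, 1, 0) u) q + dirDeriv (0, 0, 1) (dirDeriv (0, 0, 1) u) q))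
    (fun q => (hd _ q).sub ((hd _ q).add (hd _ q)))
    (fun q hq => by rw [hu.wave q hq, sub_self]) e hp
  rw [dirDeriv_sub e (hd _ p) ((hd _ p).fun_add (hd _ p)),
    dirDeriv_add e (hd _ p) (hd _ p)] at hzero
  rw [hcomm, hcomm, hcomm]
  exact sub_eq_zero.1 hzero

theorem IsHalfWave.dirDeriv_tangential {s : ℝ} {u : ℝ × ℝ × ℝ → ℂ} (hu : IsHalfWave s u)
    {e : ℝ × ℝ × ℝ} (he : e.2.1 = 0) : IsHalfWave s (dirDeriv e u) where
  contDiff := hu.contDiff.dirDeriv e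
  wave _ hp := hu.wave_dirDeriv e hp
  boundary := by
    rcases hu.boundary with ⟨hs, h⟩ | ⟨hs, h⟩
    · exact Or.inl ⟨hs, dirDeriv_eq_zero_of_boundary (hu.contDiff.differentiable (by simp)) h he⟩
    · refine Or.inr ⟨hs, fun t y => ?_⟩
      rw [dirDeriv_comm hu.contDiff]
      exact dirDeriv_eq_zero_of_boundary
        ((hu.contDiff.dirDeriv _).differentiable (by simp)) h he t y

theorem IsHalfWave.dirDeriv_normal {s : ℝ} {u : ℝ × ℝ × ℝ → ℂ} (hu : IsHalfWave s u) :
    IsHalfWave (-s) (dirDeriv (0, 1, 0) u) where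
  contDiff := hu.contDiff.dirDeriv _
  wave _ hp := hu.wave_dirDeriv _ hp
  boundary := by
    rcases hu.boundary with ⟨hs, h⟩ | ⟨hs, h⟩
    · refine Or.inr ⟨by simp [hs], fun t y => ?_⟩
      have htan : ∀ e : ℝ × ℝ × ℝ, e.2.1 = 0 → dirDeriv e (dirDeriv e u) (t, 0, y) = 0 :=
        fun e he => dirDeriv_eq_zero_of_boundary
          ((hu.contDiff.dirDeriv e).differentiable (by simp))
          (dirDeriv_eq_zero_of_boundary (hu.contDiff.differentiable (by simp)) h he) he t y
      have := hu.wave (t, 0, y) le_rfl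
      rw [htan (1, 0, 0) rfl, htan (0, 0, 1) rfl, add_zero] at this
      exact this.symm
    · exact Or.inl ⟨by simp [hs], h⟩

/-- The linear map with given values on the three coordinate vectors. -/
noncomputable def gradCLM : ℂ × ℂ × ℂ →L[ℝ] (ℝ × ℝ × ℝ →L[ℝ] ℂ) :=
  LinearMap.toContinuousLinearMap
    { toFun := fun c => (ContinuousLinearMap.fst ℝ ℝ (ℝ × ℝ)).smulRight c.1 +
        ((ContinuousLinearMap.fst ℝ ℝ ℝ).comp
          (ContinuousLinearMap.snd ℝ ℝ (ℝ × ℝ))).smulRight c.2.1 +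
        ((ContinuousLinearMap.snd ℝ ℝ ℝ).comp
          (ContinuousLinearMap.snd ℝ ℝ (ℝ × ℝ))).smulRight c.2.2
      map_add' := fun a b => by ext <;> simp
      map_smul' := fun a b => by ext <;> simp }

theorem gradCLM_apply (c : ℂ × ℂ × ℂ) (v : ℝ × ℝ × ℝ) :
    gradCLM c v = v.1 • c.1 + v.2.1 • c.2.1 + v.2.2 • c.2.2 := rfl

theorem gradCLM_dirDeriv (u : ℝ × ℝ × ℝ → ℂ) (p : ℝ × ℝ × ℝ) :
    gradCLM (dirDeriv (1, 0, 0) u p, dirDeriv (0, 1, 0) u p, dirDeriv (0, 0, 1) u p) =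
      fderiv ℝ u p := by
  ext <;> simp [gradCLM_apply, dirDeriv]
  rfl

theorem IsHalfWave.hasFDerivAt_reflectExtend {s : ℝ} {u : ℝ × ℝ × ℝ → ℂ} (hu : IsHalfWave s u)
    (p : ℝ × ℝ × ℝ) :
    HasFDerivAt (reflectExtend s u) (gradCLM (reflectExtend s (dirDeriv (1, 0, 0) u) p,
      reflectExtend (-s) (dirDeriv (0, 1, 0) u) p,
      reflectExtend s (dirDeriv (0, 0, 1) u) p)) p := by
  have hd := hu.contDiff.differentiable (by simp)
  have heven : ∀ (r : ℝ) (z : ℝ × ℝ × ℝ → ℂ), (r = -1 ∧ (∀ t y : ℝ, z (t, 0, y) = 0)) ∨ r = 1 →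
      ∀ q : ℝ × ℝ × ℝ, q.2.1 ≤ 0 → reflectExtend r z q = r • z (reflectX q) := by
    intro r z hz q hq
    rcases hq.lt_or_eq with h | h
    · simp [reflectExtend, h.not_ge]
    · obtain ⟨t, x, y⟩ := q
      obtain rfl : x = 0 := h
      rcases hz with ⟨rfl, hz⟩ | rfl <;> simp [reflectExtend]
      simp [hz]
  have hval : ∀ {r : ℝ} {z : ℝ × ℝ × ℝ → ℂ}, IsHalfWave r z →
      ∀ q : ℝ × ℝ × ℝ, q.2.1 ≤ 0 → reflectExtend r z q = r • z (reflectX q) := fun {r z} hz =>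
    heven r z (hz.boundary.imp id And.left)
  have hright : HasFDerivWithinAt (reflectExtend s u) (gradCLM
      (reflectExtend s (dirDeriv (1, 0, 0) u) p, reflectExtend (-s) (dirDeriv (0, 1, 0) u) p,
      reflectExtend s (dirDeriv (0, 0, 1) u) p)) {q | 0 ≤ q.2.1} p := by
    by_cases hp : 0 ≤ p.2.1
    · simp only [reflectExtend, if_pos hp, gradCLM_dirDeriv]
      exact (hd p).hasFDerivAt.hasFDerivWithinAt.congr (fun q hq => if_pos hq) (if_pos hp)
    · refine HasFDerivWithinAt.of_notMem_closure ?_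
      rwa [(isClosed_le continuous_const (by fun_prop)).closure_eq]
  have hleft : HasFDerivWithinAt (reflectExtend s u) (gradCLM
      (reflectExtend s (dirDeriv (1, 0, 0) u) p, reflectExtend (-s) (dirDeriv (0, 1, 0) u) p,
      reflectExtend s (dirDeriv (0, 0, 1) u) p)) {q | q.2.1 ≤ 0} p := by
    by_cases hp : p.2.1 ≤ 0
    · rw [hval (hu.dirDeriv_tangential rfl) p hp, hval (hu.dirDeriv_tangential rfl) p hp,
        hval hu.dirDeriv_normal p hp]
      have hcomp := ((hd (reflectX p)).hasFDerivAt.comp p reflectX.hasFDerivAt).const_smul s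
      refine (hcomp.hasFDerivWithinAt.congr (fun q hq => hval hu q hq)
        (hval hu p hp)).congr_fderiv ?_
      rw [← gradCLM_dirDeriv]
      ext <;> simp [gradCLM_apply]
    · refine HasFDerivWithinAt.of_notMem_closure ?_
      rwa [(isClosed_le (by fun_prop) continuous_const).closure_eq]
  have := hright.union hleft
  rwa [show {q : ℝ × ℝ × ℝ | 0 ≤ q.2.1} ∪ {q | q.2.1 ≤ 0} = univ from
    eq_univ_of_forall fun q => le_total 0 q.2.1, hasFDerivWithinAt_univ] at this

theorem IsHalfWave.contDiff_reflectExtend (n : ℕ) : ∀ {s : ℝ} {u : ℝ × ℝ × ℝ → ℂ},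
    IsHalfWave s u → ContDiff ℝ n (reflectExtend s u) := by
  induction n with
  | zero =>
    intro s u hu
    refine contDiff_zero.2 (continuous_iff_continuousAt.2 fun p => ?_)
    exact (hu.hasFDerivAt_reflectExtend p).continuousAt
  | succ n ih =>
    intro s u hu
    rw [Nat.cast_add, Nat.cast_one]
    refine contDiff_succ_iff_hasFDerivAt.2 ⟨_, ?_, hu.hasFDerivAt_reflectExtend⟩
    exact gradCLM.contDiff.comp ((ih (hu.dirDeriv_tangential rfl)).prodMk
      ((ih hu.dirDeriv_normal).prodMk (ih (hu.dirDeriv_tangential rfl))))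

theorem IsHalfWave.isWave_reflectExtend {s : ℝ} {u : ℝ × ℝ × ℝ → ℂ} (hu : IsHalfWave s u) :
    IsWave (reflectExtend s u) where
  contDiff := contDiff_infty.2 fun n => hu.contDiff_reflectExtend n
  wave p := by
    have htan : ∀ {r : ℝ} {z : ℝ × ℝ × ℝ → ℂ}, IsHalfWave r z →
        dirDeriv (1, 0, 0) (reflectExtend r z) = reflectExtend r (dirDeriv (1, 0, 0) z) ∧
        dirDeriv (0, 1, 0) (reflectExtend r z) = reflectExtend (-r) (dirDeriv (0, 1, 0) z) ∧
        dirDeriv (0, 0, 1) (reflectExtend r z) = reflectExtend r (dirDeriv (0, 0, 1) z) := by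
      intro r z hz
      refine ⟨?_, ?_, ?_⟩ <;> ext q <;>
        simp [dirDeriv, (hz.hasFDerivAt_reflectExtend q).fderiv, gradCLM_apply]
    rw [(htan hu).1, (htan hu).2.1, (htan hu).2.2, (htan (hu.dirDeriv_tangential rfl)).1,
      (htan hu.dirDeriv_normal).2.1, (htan (hu.dirDeriv_tangential rfl)).2.2, neg_neg]
    by_cases hp : 0 ≤ p.2.1
    · simpa [reflectExtend, hp] using hu.wave p hp
    · have := hu.wave (reflectX p) (by simp at hp ⊢; exact hp.le)
      simp only [reflectExtend, if_neg hp, this, smul_add]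

end Reflection

section FourierSeries

open Set MeasureTheory SchwartzMap FourierTransform

/-- The representative of a point of the unit torus in the cube `(-1/2, 1/2]ᵈ`. -/
noncomputable def torusRep {d : Type*} (z : UnitAddTorus d) : EuclideanSpace ℝ d :=
  WithLp.toLp 2 fun i => (AddCircle.equivIoc 1 (-1 / 2) (z i) : ℝ)

theorem torusRep_coe {d : Type*} {x : d → ℝ} (hx : ∀ i, x i ∈ Ioc (-1 / 2 : ℝ) (-1 / 2 + 1)) :
    torusRep (fun i => (x i : UnitAddCircle)) = WithLp.toLp 2 x := by
  ext i
  exact AddCircle.equivIoc_coe_of_mem (p := (1 : ℝ)) (a := -1 / 2) (hx i)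

theorem abs_torusRep {d : Type*} (z : UnitAddTorus d) (i : d) : |torusRep z i| = ‖z i‖ := by
  have h := (AddCircle.equivIoc (1 : ℝ) (-1 / 2) (z i)).2
  have h' : ‖((torusRep z i : ℝ) : UnitAddCircle)‖ = |torusRep z i| := by
    refine (AddCircle.norm_coe_eq_abs_iff 1 one_ne_zero).2 ?_
    rw [abs_one, abs_le]
    constructor
    · linarith [show (-1 / 2 : ℝ) < torusRep z i from h.1]
    · linarith [show torusRep z i ≤ -1 / 2 + 1 from h.2]
  rw [← h']
  exact congrArg _ (AddCircle.coe_equivIoc (p := (1 : ℝ)) (a := -1 / 2))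

theorem continuous_comp_torusRep {d : Type*} [Fintype d] {g : EuclideanSpace ℝ d → ℂ}
    (hg : Continuous g) (hsupp : ∀ x, ∀ i, 1 / 4 < |x i| → g x = 0) :
    Continuous fun z => g (torusRep z) := by
  refine continuous_iff_continuousAt.2 fun z => ?_
  by_cases hz : ∀ i, z i ≠ ((-1 / 2 : ℝ) : UnitAddCircle)
  · refine hg.continuousAt.comp ((PiLp.continuous_toLp 2 _).continuousAt.comp ?_)
    refine continuousAt_pi.2 fun i => ?_
    have h1 := AddCircle.continuousAt_equivIoc (1 : ℝ) (-1 / 2) (hz i)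
    exact (continuous_subtype_val.continuousAt.comp h1).comp
      (f := fun w : UnitAddTorus d => w i) (continuous_apply i).continuousAt
  · push Not at hz
    obtain ⟨i, hi⟩ := hz
    have hnorm : 1 / 4 < ‖z i‖ := by
      rw [hi, (AddCircle.norm_coe_eq_abs_iff 1 one_ne_zero).2 (by norm_num [abs_div])]
      norm_num [abs_div]
    have hev : ∀ᶠ w : UnitAddTorus d in nhds z, 1 / 4 < ‖w i‖ :=
      (continuous_apply i).norm.continuousAt.eventually (lt_mem_nhds hnorm)
    refine (continuousAt_const (y := (0 : ℂ))).congr ?_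
    filter_upwards [hev] with w hw
    exact (hsupp _ i (by rwa [abs_torusRep])).symm

theorem mFourier_coe {d : Type*} [Fintype d] (n : d → ℤ) (x : d → ℝ) :
    UnitAddTorus.mFourier n (fun i => (x i : UnitAddCircle)) =
      Complex.exp (2 * Real.pi * Complex.I * ∑ i, n i * x i) := by
  simp only [UnitAddTorus.mFourier, ContinuousMap.coe_mk, fourier_coe_apply]
  rw [← Complex.exp_sum, Complex.ofReal_sum, Finset.mul_sum]
  refine congrArg _ (Finset.sum_congr rfl fun i _ => ?_)
  push_cast
  ring

/-- The Fourier coefficients of the periodization of a function supported in the unit cube are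
values of its Fourier transform. -/
theorem mFourierCoeff_comp_torusRep {d : Type*} [Fintype d] {g : EuclideanSpace ℝ d → ℂ}
    (hsupp : ∀ x, ∀ i, 1 / 4 < |x i| → g x = 0) (n : d → ℤ) :
    UnitAddTorus.mFourierCoeff (fun z => g (torusRep z)) n =
      𝓕 g (WithLp.toLp 2 fun i => (n i : ℝ)) := by
  rw [UnitAddTorus.mFourierCoeff_eq_integral _ n (fun _ => -1 / 2), Real.fourier_eq,
    ← (PiLp.volume_preserving_toLp d).integral_comp
      (MeasurableEquiv.toLp 2 (d → ℝ)).measurableEmbedding]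
  refine (setIntegral_congr_fun (MeasurableSet.univ_pi' fun i : d => measurableSet_Ioc)
    fun x hx => ?_).trans (setIntegral_eq_integral_of_forall_compl_eq_zero fun x hx => ?_)
  · simp only
    rw [torusRep_coe hx, mFourier_coe, Circle.smul_def, Real.fourierChar_apply]
    congr 2
    simp [PiLp.inner_apply]
    ring
  · simp only [mem_ofPred_eq, not_forall] at hx
    obtain ⟨i, hi⟩ := hx
    rw [hsupp _ i, smul_zero]
    by_contra! h
    have h' : |x i| ≤ 1 / 4 := h
    rw [abs_le] at h'
    exact hi ⟨by linarith [h'.1], by linarith [h'.2]⟩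

theorem hasSum_fourier_of_support {d : Type*} [Fintype d] {g : EuclideanSpace ℝ d → ℂ}
    (hg : Continuous g) (hsupp : ∀ x, ∀ i, 1 / 4 < |x i| → g x = 0)
    (hsum : Summable fun n : d → ℤ => 𝓕 g (WithLp.toLp 2 fun i => (n i : ℝ)))
    {x : d → ℝ} (hx : ∀ i, |x i| < 1 / 2) :
    HasSum (fun n : d → ℤ => 𝓕 g (WithLp.toLp 2 fun i => (n i : ℝ)) *
      Complex.exp (2 * Real.pi * Complex.I * ∑ i, n i * x i)) (g (WithLp.toLp 2 x)) := by
  let f : C(UnitAddTorus d, ℂ) := ⟨fun z => g (torusRep z), continuous_comp_torusRep hg hsupp⟩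
  have hcoeff : UnitAddTorus.mFourierCoeff f =
      fun n : d → ℤ => 𝓕 g (WithLp.toLp 2 fun i => (n i : ℝ)) :=
    funext fun n => mFourierCoeff_comp_torusRep hsupp n
  have h := UnitAddTorus.hasSum_mFourier_series_apply_of_summable (f := f)
    (by rwa [hcoeff]) fun i => (x i : UnitAddCircle)
  have hval : f (fun i => (x i : UnitAddCircle)) = g (WithLp.toLp 2 x) := by
    change g (torusRep _) = _
    rw [torusRep_coe fun i => ?_]
    have := abs_lt.1 (hx i)
    exact ⟨by linarith [this.1], by linarith [this.2]⟩
  rw [hval, hcoeff] at h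
  simpa only [mFourier_coe, smul_eq_mul] using h

/-- Rapid decay of the Fourier transform of a Schwartz function along the integer lattice. -/
theorem summable_norm_pow_mul_fourier (g : 𝓢(EuclideanSpace ℝ (Fin 2), ℂ)) (k : ℕ) :
    Summable fun n : Fin 2 → ℤ =>
      ‖n‖ ^ k * ‖𝓕 (g : EuclideanSpace ℝ (Fin 2) → ℂ) (WithLp.toLp 2 fun i => (n i : ℝ))‖ := by
  obtain ⟨C, hC0, hC⟩ := (𝓕 g).decay (k + 3) 0
  have hs := (EisensteinSeries.summable_one_div_norm_rpow (k := 3) (by norm_num)).mul_left C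
  refine Summable.of_norm_bounded_eventually hs ?_
  have hfin : ({0} : Set (Fin 2 → ℤ)).Finite := finite_singleton 0
  filter_upwards [hfin.compl_mem_cofinite] with n hn
  have hn0 : 0 < ‖n‖ := norm_pos_iff.2 hn
  have hle : ‖n‖ ≤ ‖(WithLp.toLp 2 fun i => (n i : ℝ) : EuclideanSpace ℝ (Fin 2))‖ := by
    refine (pi_norm_le_iff_of_nonneg (norm_nonneg _)).2 fun i => ?_
    have := PiLp.norm_apply_le (WithLp.toLp 2 fun i => (n i : ℝ) : EuclideanSpace ℝ (Fin 2)) i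
    simpa [Int.norm_eq_abs] using this
  have := hC (WithLp.toLp 2 fun i => (n i : ℝ))
  rw [norm_iteratedFDeriv_zero, SchwartzMap.fourier_coe] at this
  rw [Real.rpow_neg hn0.le, norm_mul, norm_pow, norm_norm, norm_norm, ← div_eq_mul_inv,
    le_div_iff₀ (by positivity)]
  refine le_trans (le_of_eq ?_) ((mul_le_mul_of_nonneg_right
    (pow_le_pow_left₀ hn0.le hle (k + 3)) (norm_nonneg _)).trans this)
  norm_cast
  ring

end FourierSeries

section FourierExpansion

open Set

/-- The basic frequency of the Fourier expansions used on the disk of radius `S`. -/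
noncomputable def baseFreq (S : ℝ) : ℝ := Real.pi / (2 * (S + 1))

theorem baseFreq_pos {S : ℝ} (hS : 0 < S) : 0 < baseFreq S := by
  have := Real.pi_pos
  unfold baseFreq
  positivity

/-- Expansion of a smooth function on a disk into exponentials, with rapidly decreasing
coefficients. -/
theorem exists_fourier_expansion {f : ℝ × ℝ → ℂ} (hf : ContDiff ℝ (⊤ : ℕ∞) f) {S : ℝ}
    (hS : 0 < S) :
    ∃ c : (Fin 2 → ℤ) → ℂ, (∀ k : ℕ, Summable fun n => ‖n‖ ^ k * ‖c n‖) ∧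
      ∀ x y : ℝ, x ^ 2 + y ^ 2 < S ^ 2 →
        HasSum (fun n => c n *
          Complex.exp (Complex.I * (baseFreq S * (n 0 * x + n 1 * y)))) (f (x, y)) := by
  let L : ℝ := 4 * (S + 1)
  have hL : 0 < L := by positivity
  let χ : ContDiffBump (0 : EuclideanSpace ℝ (Fin 2)) :=
    ⟨S / L, 1 / 4, by positivity, by rw [div_lt_iff₀ hL]; simp only [L]; linarith⟩
  let g : EuclideanSpace ℝ (Fin 2) → ℂ := fun z => χ z • f (L * z 0, L * z 1)
  have hχ : ContDiff ℝ (⊤ : ℕ∞) χ := χ.contDiff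
  have hg : ContDiff ℝ (⊤ : ℕ∞) g :=
    hχ.smul (hf.comp (by fun_prop))
  have hsupp : HasCompactSupport g := χ.hasCompactSupport.smul_right
  have hzero : ∀ z : EuclideanSpace ℝ (Fin 2), ∀ i, 1 / 4 < |z i| → g z = 0 := by
    intro z i hz
    have h1 : χ z = 0 := χ.zero_of_le_dist (by
      rw [dist_zero_right]
      exact hz.le.trans (by simpa using PiLp.norm_apply_le z i))
    simp [g, h1]
  let G := hsupp.toSchwartzMap hg
  have hG : (G : EuclideanSpace ℝ (Fin 2) → ℂ) = g := rfl
  have hsum := summable_norm_pow_mul_fourier G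
  rw [hG] at hsum
  refine ⟨_, hsum, fun x y hxy => ?_⟩
  have hzS : ‖(WithLp.toLp 2 ![x / L, y / L] : EuclideanSpace ℝ (Fin 2))‖ < S / L := by
    rw [EuclideanSpace.norm_eq, Real.sqrt_lt' (by positivity)]
    simp only [Fin.sum_univ_two, Matrix.cons_val_zero, Matrix.cons_val_one, Real.norm_eq_abs,
      sq_abs, div_pow, ← add_div]
    exact div_lt_div_of_pos_right hxy (by positivity)
  have hSL : S / L < 1 / 4 := χ.rIn_lt_rOut
  have h := hasSum_fourier_of_support hg.continuous hzero
    (Summable.of_norm (by simpa using hsum 0)) (x := ![x / L, y / L]) (fun i => by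
      have := PiLp.norm_apply_le (WithLp.toLp 2 ![x / L, y / L] : EuclideanSpace ℝ (Fin 2)) i
      rw [Real.norm_eq_abs] at this
      exact this.trans_lt (hzS.trans (hSL.trans (by norm_num))))
  have hval : g (WithLp.toLp 2 ![x / L, y / L]) = f (x, y) := by
    have h1 : χ (WithLp.toLp 2 ![x / L, y / L]) = 1 :=
      χ.one_of_mem_closedBall (by rw [mem_closedBall_zero_iff]; exact hzS.le)
    simp [g, h1, mul_div_cancel₀ _ hL.ne']
  rw [hval] at h
  convert h using 4 with n
  simp only [Fin.sum_univ_two, Matrix.cons_val_zero, Matrix.cons_val_one, baseFreq, L]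
  push_cast
  have : (S : ℂ) + 1 ≠ 0 := by exact_mod_cast (by positivity : S + 1 ≠ 0)
  field_simp
  ring

end FourierExpansion

section SmoothSeries

open Set Filter Topology

variable {ι E F : Type*} [NormedAddCommGroup E] [NormedSpace ℝ E]
  [NormedAddCommGroup F] [NormedSpace ℝ F]

/-- Families of smooth functions all of whose derivatives are normally summable. -/
structure SmoothSummable (f : ι → E → F) : Prop where
  contDiff : ∀ i, ContDiff ℝ (⊤ : ℕ∞) (f i)
  bound : ∀ k : ℕ, ∃ v : ι → ℝ, Summable v ∧ ∀ i x, ‖iteratedFDeriv ℝ k (f i) x‖ ≤ v i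

theorem SmoothSummable.summable [CompleteSpace F] {f : ι → E → F} (hf : SmoothSummable f) (x : E) :
    Summable fun i => f i x := by
  obtain ⟨v, hv, h⟩ := hf.bound 0
  exact Summable.of_norm_bounded hv fun i => by simpa using h i x

theorem SmoothSummable.contDiff_tsum [CompleteSpace F] {f : ι → E → F} (hf : SmoothSummable f) :
    ContDiff ℝ (⊤ : ℕ∞) fun x => ∑' i, f i x := by
  choose v hv h using hf.bound
  exact _root_.contDiff_tsum hf.contDiff (fun k _ => hv k) fun k i x _ => h k i x

theorem SmoothSummable.dirDeriv {f : ι → E → F} (hf : SmoothSummable f) (e : E) :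
    SmoothSummable fun i => dirDeriv e (f i) where
  contDiff i := (hf.contDiff i).dirDeriv e
  bound k := by
    obtain ⟨v, hv, h⟩ := hf.bound (k + 1)
    refine ⟨fun i => ‖e‖ * v i, hv.mul_left _, fun i x => ?_⟩
    have hd : ContDiff ℝ (⊤ : ℕ∞) (fderiv ℝ (f i)) :=
      (hf.contDiff i).fderiv_right (by simp)
    refine (norm_iteratedFDeriv_clm_apply_const (n := k) hd.contDiffAt
      (by exact_mod_cast le_top)).trans ?_
    rw [norm_iteratedFDeriv_fderiv]
    exact mul_le_mul_of_nonneg_left (h i x) (norm_nonneg e)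

theorem SmoothSummable.dirDeriv_tsum [CompleteSpace F] {f : ι → E → F} (hf : SmoothSummable f)
    (e : E) :
    (_root_.dirDeriv e fun x => ∑' i, f i x) = fun x => ∑' i, _root_.dirDeriv e (f i) x := by
  ext x
  obtain ⟨v, hv, h⟩ := hf.bound 1
  have hle : ∀ i y, ‖fderiv ℝ (f i) y‖ ≤ v i := fun i y => by
    rw [← norm_iteratedFDeriv_one]
    exact h i y
  have hs : Summable fun i => fderiv ℝ (f i) x := Summable.of_norm_bounded hv fun i => hle i x
  rw [_root_.dirDeriv, fderiv_tsum_apply hv (fun i => (hf.contDiff i).differentiable (by simp))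
    hle (hf.summable x)]
  exact (ContinuousLinearMap.apply ℝ F e).map_tsum hs

theorem SmoothSummable.eventually_norm_iteratedFDeriv_tsum_sub_le [CompleteSpace F]
    {f : ι → E → F} (hf : SmoothSummable f) (k : ℕ) {ε : ℝ} (hε : 0 < ε) :
    ∀ᶠ s : Finset ι in atTop, ∀ x,
      ‖iteratedFDeriv ℝ k (fun y => ∑' i, f i y - ∑ i ∈ s, f i y) x‖ ≤ ε := by
  have hb := hf.bound
  choose v hv h using hb
  have hu := tendstoUniformly_tsum (hv k) (h k)
  filter_upwards [Metric.tendstoUniformly_iff.1 hu ε hε] with s hs x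
  have hsum : ContDiff ℝ (⊤ : ℕ∞) fun y => ∑ i ∈ s, f i y :=
    ContDiff.sum fun i _ => hf.contDiff i
  have hk : (k : WithTop ℕ∞) ≤ ((⊤ : ℕ∞) : WithTop ℕ∞) := by exact_mod_cast le_top
  have h1 := iteratedFDeriv_sub_apply (𝕜 := ℝ) (i := k) (x := x)
    ((hf.contDiff_tsum.of_le hk).contDiffAt) ((hsum.of_le hk).contDiffAt)
  have h2 := iteratedFDeriv_fun_sum_apply (𝕜 := ℝ) (u := s) (n := k) (x := x) fun i _ =>
    ((hf.contDiff i).of_le hk).contDiffAt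
  have h3 := iteratedFDeriv_tsum_apply hf.contDiff (fun k _ => hv k) (fun k i x _ => h k i x)
    (k := k) le_top x
  have h4 := hs x
  rw [dist_eq_norm] at h4
  refine le_trans (le_of_eq ?_) h4.le
  congr 1
  rw [← h3, ← h2]
  exact h1

theorem IsWave.tsum [CompleteSpace F] {f : ι → ℝ × ℝ × ℝ → F} (hf : SmoothSummable f)
    (hw : ∀ i, IsWave (f i)) : IsWave fun p => ∑' i, f i p where
  contDiff := hf.contDiff_tsum
  wave p := by
    have h : ∀ e, dirDeriv e (dirDeriv e fun x => ∑' i, f i x) =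
        fun x => ∑' i, dirDeriv e (dirDeriv e (f i)) x := fun e => by
      rw [hf.dirDeriv_tsum, (hf.dirDeriv e).dirDeriv_tsum]
    have hs : ∀ e, Summable fun i => dirDeriv e (dirDeriv e (f i)) p := fun e =>
      ((hf.dirDeriv e).dirDeriv e).summable p
    simp only [h, fun i => (hw i).wave p]
    exact (hs _).tsum_add (hs _)

end SmoothSeries

section PlaneWaves

/-- The linear form `(t, x, y) ↦ α t + β x + γ y`. -/
noncomputable def linearPhase (α β γ : ℝ) : ℝ × ℝ × ℝ →L[ℝ] ℝ :=
  α • ContinuousLinearMap.fst ℝ ℝ (ℝ × ℝ) +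
    β • (ContinuousLinearMap.fst ℝ ℝ ℝ).comp (ContinuousLinearMap.snd ℝ ℝ (ℝ × ℝ)) +
    γ • (ContinuousLinearMap.snd ℝ ℝ ℝ).comp (ContinuousLinearMap.snd ℝ ℝ (ℝ × ℝ))

@[simp]
theorem linearPhase_apply (α β γ : ℝ) (p : ℝ × ℝ × ℝ) :
    linearPhase α β γ p = α * p.1 + β * p.2.1 + γ * p.2.2 := rfl

theorem norm_linearPhase_le (α β γ : ℝ) : ‖linearPhase α β γ‖ ≤ |α| + |β| + |γ| := by
  refine ContinuousLinearMap.opNorm_le_bound _ (by positivity) fun p => ?_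
  have h1 : |p.1| ≤ ‖p‖ := norm_fst_le p
  have h2 : |p.2.1| ≤ ‖p‖ := (norm_fst_le p.2).trans (norm_snd_le p)
  have h3 : |p.2.2| ≤ ‖p‖ := (norm_snd_le p.2).trans (norm_snd_le p)
  rw [linearPhase_apply, Real.norm_eq_abs]
  calc |α * p.1 + β * p.2.1 + γ * p.2.2|
      ≤ |α * p.1| + |β * p.2.1| + |γ * p.2.2| := abs_add_three _ _ _
    _ = |α| * |p.1| + |β| * |p.2.1| + |γ| * |p.2.2| := by simp only [abs_mul]
    _ ≤ |α| * ‖p‖ + |β| * ‖p‖ + |γ| * ‖p‖ := by gcongr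
    _ = (|α| + |β| + |γ|) * ‖p‖ := by ring

/-- The plane wave `exp (i ℓ)`. -/
noncomputable def planeWave (ℓ : ℝ × ℝ × ℝ →L[ℝ] ℝ) (p : ℝ × ℝ × ℝ) : ℂ :=
  Complex.exp (Complex.I * ℓ p)

theorem iteratedDeriv_cexp_I_mul (k : ℕ) :
    iteratedDeriv k (fun s : ℝ => Complex.exp (Complex.I * s)) =
      fun s : ℝ => Complex.I ^ k * Complex.exp (Complex.I * s) := by
  induction k with
  | zero => simp
  | succ k ih =>
    rw [iteratedDeriv_succ, ih]
    ext s
    have h : HasDerivAt (fun s : ℝ => Complex.I * (s : ℂ)) (Complex.I * 1) s :=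
      (Complex.ofRealCLM.hasDerivAt (x := s)).const_mul Complex.I
    have h' : HasDerivAt (fun s : ℝ => Complex.I ^ k * Complex.exp (Complex.I * s))
        (Complex.I ^ k * (Complex.exp (Complex.I * s) * (Complex.I * 1))) s :=
      h.cexp.const_mul _
    rw [h'.deriv]
    ring

theorem contDiff_cexp_I_mul :
    ContDiff ℝ (⊤ : ℕ∞) fun s : ℝ => Complex.exp (Complex.I * s) :=
  (contDiff_const.mul Complex.ofRealCLM.contDiff).cexp

theorem contDiff_planeWave (ℓ : ℝ × ℝ × ℝ →L[ℝ] ℝ) : ContDiff ℝ (⊤ : ℕ∞) (planeWave ℓ) :=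
  contDiff_cexp_I_mul.comp ℓ.contDiff

theorem norm_iteratedFDeriv_planeWave_le (ℓ : ℝ × ℝ × ℝ →L[ℝ] ℝ) (k : ℕ) (p : ℝ × ℝ × ℝ) :
    ‖iteratedFDeriv ℝ k (planeWave ℓ) p‖ ≤ ‖ℓ‖ ^ k := by
  have h := ℓ.iteratedFDeriv_comp_right contDiff_cexp_I_mul p (i := k)
    (by exact_mod_cast le_top)
  change ‖iteratedFDeriv ℝ k ((fun s : ℝ => Complex.exp (Complex.I * s)) ∘ ℓ) p‖ ≤ _
  rw [h]
  refine (ContinuousMultilinearMap.norm_compContinuousLinearMap_le _ _).trans (le_of_eq ?_)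
  rw [norm_iteratedFDeriv_eq_norm_iteratedDeriv, iteratedDeriv_cexp_I_mul]
  simp [Complex.norm_exp]

theorem dirDeriv_planeWave (ℓ : ℝ × ℝ × ℝ →L[ℝ] ℝ) (e : ℝ × ℝ × ℝ) :
    dirDeriv e (planeWave ℓ) = fun p => Complex.I * ℓ e * planeWave ℓ p := by
  ext p
  have h : HasFDerivAt (fun q => Complex.I * (ℓ q : ℂ))
      (Complex.I • (Complex.ofRealCLM.comp ℓ)) p :=
    (Complex.ofRealCLM.comp ℓ).hasFDerivAt.const_mul Complex.I
  have h' : HasFDerivAt (planeWave ℓ)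
      (planeWave ℓ p • (Complex.I • (Complex.ofRealCLM.comp ℓ))) p :=
    h.cexp
  simp only [dirDeriv, h'.fderiv, smul_apply, ContinuousLinearMap.comp_apply,
    Complex.ofRealCLM_apply, smul_eq_mul]
  ring

theorem dirDeriv_const_mul {E : Type*} [NormedAddCommGroup E] [NormedSpace ℝ E] {f : E → ℂ}
    (hf : Differentiable ℝ f) (c : ℂ) (e : E) :
    dirDeriv e (fun q => c * f q) = fun p => c * dirDeriv e f p :=
  dirDeriv_clm_comp (ContinuousLinearMap.mul ℝ ℂ c) hf e

theorem isWave_planeWave {α β γ : ℝ} (h : α ^ 2 = β ^ 2 + γ ^ 2) :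
    IsWave (planeWave (linearPhase α β γ)) where
  contDiff := contDiff_planeWave _
  wave p := by
    have hd := (contDiff_planeWave (linearPhase α β γ)).differentiable (by simp)
    have h' : (α : ℂ) ^ 2 = β ^ 2 + γ ^ 2 := by exact_mod_cast h
    simp only [dirDeriv_planeWave, dirDeriv_const_mul hd, linearPhase_apply]
    push_cast
    linear_combination (Complex.I ^ 2 * planeWave (linearPhase α β γ) p) * h'

theorem waveDirichletBasis_I_mul (α β γ : ℝ) :
    waveDirichletBasis (Complex.I * α) (Complex.I * β) (Complex.I * γ) =
      fun p => planeWave (linearPhase α β γ) p - planeWave (linearPhase α (-β) γ) p := by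
  ext p
  simp only [waveDirichletBasis, planeWave, linearPhase_apply]
  push_cast
  congr 2 <;> ring

theorem isWave_waveDirichletBasis {α β γ : ℝ} (h : α ^ 2 = β ^ 2 + γ ^ 2) :
    IsWave (waveDirichletBasis (Complex.I * α) (Complex.I * β) (Complex.I * γ)) := by
  rw [waveDirichletBasis_I_mul]
  exact (isWave_planeWave h).sub (isWave_planeWave (by rw [h, neg_sq]))

theorem norm_iteratedFDeriv_waveDirichletBasis_le (α β γ : ℝ) (k : ℕ) (p : ℝ × ℝ × ℝ) :
    ‖iteratedFDeriv ℝ k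
      (waveDirichletBasis (Complex.I * α) (Complex.I * β) (Complex.I * γ)) p‖ ≤
      2 * (|α| + |β| + |γ|) ^ k := by
  have hk : (k : WithTop ℕ∞) ≤ ((⊤ : ℕ∞) : WithTop ℕ∞) := by exact_mod_cast le_top
  have h1 := iteratedFDeriv_sub_apply (𝕜 := ℝ) (i := k) (x := p)
    ((contDiff_planeWave (linearPhase α β γ)).of_le hk).contDiffAt
    ((contDiff_planeWave (linearPhase α (-β) γ)).of_le hk).contDiffAt
  have h2 : ∀ b : ℝ, |b| = |β| →
      ‖iteratedFDeriv ℝ k (planeWave (linearPhase α b γ)) p‖ ≤ (|α| + |β| + |γ|) ^ k := by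
    intro b hb
    refine (norm_iteratedFDeriv_planeWave_le _ k p).trans ?_
    rw [← hb]
    exact pow_le_pow_left₀ (norm_nonneg _) (norm_linearPhase_le α b γ) k
  rw [waveDirichletBasis_I_mul]
  refine (congrArg norm h1).trans_le ((norm_sub_le _ _).trans ?_)
  linarith [h2 β rfl, h2 (-β) (abs_neg β)]

end PlaneWaves

section Modes

/-- The time frequency of the Fourier mode `i`, whose second component is the direction of
propagation. -/
noncomputable def timeFreq (ω : ℝ) (i : (Fin 2 → ℤ) × Bool) : ℝ :=
  (if i.2 then ω else -ω) * √((i.1 0 : ℝ) ^ 2 + (i.1 1 : ℝ) ^ 2)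

/-- The element of the Dirichlet basis attached to a Fourier mode. -/
noncomputable def dirichletMode (ω : ℝ) (i : (Fin 2 → ℤ) × Bool) : ℝ × ℝ × ℝ → ℂ :=
  waveDirichletBasis (Complex.I * timeFreq ω i) (Complex.I * (ω * i.1 0 : ℝ))
    (Complex.I * (ω * i.1 1 : ℝ))

/-- The coefficient of a Dirichlet mode in the solution whose Cauchy data have Fourier coefficients
`c` and `d`. -/
noncomputable def modeCoeff (ω : ℝ) (c d : (Fin 2 → ℤ) → ℂ) (i : (Fin 2 → ℤ) × Bool) : ℂ :=
  c i.1 / 4 + d i.1 / (4 * (Complex.I * timeFreq ω i))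

theorem sq_timeFreq (ω : ℝ) (i : (Fin 2 → ℤ) × Bool) :
    timeFreq ω i ^ 2 = (ω * i.1 0) ^ 2 + (ω * i.1 1) ^ 2 := by
  have h : (if i.2 then ω else -ω) ^ 2 = ω ^ 2 := by split_ifs <;> simp
  rw [timeFreq, mul_pow, Real.sq_sqrt (by positivity), h]
  ring

theorem abs_timeFreq {ω : ℝ} (hω : 0 < ω) (i : (Fin 2 → ℤ) × Bool) :
    |timeFreq ω i| = ω * √((i.1 0 : ℝ) ^ 2 + (i.1 1 : ℝ) ^ 2) := by
  have h : |if i.2 then ω else -ω| = ω := by split_ifs <;> simp [hω.le]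
  rw [timeFreq, abs_mul, h, abs_of_nonneg (Real.sqrt_nonneg _)]

theorem abs_timeFreq_le {ω : ℝ} (hω : 0 < ω) (i : (Fin 2 → ℤ) × Bool) :
    |timeFreq ω i| ≤ ω * (2 * ‖i.1‖) := by
  rw [abs_timeFreq hω]
  refine mul_le_mul_of_nonneg_left (Real.sqrt_le_iff.2 ⟨by positivity, ?_⟩) hω.le
  have h : ∀ j, (i.1 j : ℝ) ^ 2 ≤ ‖i.1‖ ^ 2 := fun j => by
    rw [← sq_abs]
    have := norm_le_pi_norm i.1 j
    rw [Int.norm_eq_abs] at this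
    exact pow_le_pow_left₀ (abs_nonneg _) this 2
  nlinarith [h 0, h 1, sq_nonneg ‖i.1‖]

theorem norm_modeCoeff_le {ω : ℝ} (hω : 0 < ω) (c d : (Fin 2 → ℤ) → ℂ) (i : (Fin 2 → ℤ) × Bool) :
    ‖modeCoeff ω c d i‖ ≤ ‖c i.1‖ + ‖d i.1‖ / ω := by
  refine (norm_add_le _ _).trans (add_le_add ?_ ?_)
  · rw [norm_div]
    refine div_le_self (norm_nonneg _) (by norm_num)
  · by_cases hi : timeFreq ω i = 0
    · rw [hi]
      simp only [Complex.ofReal_zero, mul_zero, div_zero, norm_zero]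
      positivity
    · rw [norm_div]
      refine div_le_div_of_nonneg_left (norm_nonneg _) hω ?_
      have hpos : 0 < (i.1 0 : ℝ) ^ 2 + (i.1 1 : ℝ) ^ 2 := by
        refine lt_of_le_of_ne (by positivity) fun h => hi ?_
        rw [timeFreq, ← h, Real.sqrt_zero, mul_zero]
      have hone : (1 : ℝ) ≤ (i.1 0 : ℝ) ^ 2 + (i.1 1 : ℝ) ^ 2 := by
        exact_mod_cast (by exact_mod_cast hpos : 0 < i.1 0 ^ 2 + i.1 1 ^ 2)
      have h1 : (1 : ℝ) ≤ √((i.1 0 : ℝ) ^ 2 + (i.1 1 : ℝ) ^ 2) := Real.one_le_sqrt.2 hone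
      have h2 : ‖(4 : ℂ) * (Complex.I * timeFreq ω i)‖ = 4 * |timeFreq ω i| := by simp
      rw [h2, abs_timeFreq hω]
      nlinarith

theorem isWave_dirichletMode (ω : ℝ) (i : (Fin 2 → ℤ) × Bool) : IsWave (dirichletMode ω i) :=
  isWave_waveDirichletBasis (sq_timeFreq ω i)

theorem smoothSummable_dirichletMode {ω : ℝ} (hω : 0 < ω) {c d : (Fin 2 → ℤ) → ℂ}
    (hc : ∀ k : ℕ, Summable fun n => ‖n‖ ^ k * ‖c n‖)
    (hd : ∀ k : ℕ, Summable fun n => ‖n‖ ^ k * ‖d n‖) :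
    SmoothSummable fun i p => modeCoeff ω c d i * dirichletMode ω i p where
  contDiff i := contDiff_const.mul (isWave_dirichletMode ω i).contDiff
  bound k := by
    have hs : Summable fun n : Fin 2 → ℤ =>
        (‖c n‖ + ‖d n‖ / ω) * (2 * (4 * ω * ‖n‖) ^ k) := by
      refine (((hc k).mul_left (2 * (4 * ω) ^ k)).add
        ((hd k).mul_left (2 * (4 * ω) ^ k / ω))).congr fun n => ?_
      rw [mul_pow]
      ring
    have hs' := hs.mul_of_nonneg (g := fun _ : Bool => (1 : ℝ)) (hasSum_fintype _).summable
      (fun n => by positivity) (fun _ => zero_le_one)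
    refine ⟨_, hs', fun i p => ?_⟩
    have hk : (k : WithTop ℕ∞) ≤ ((⊤ : ℕ∞) : WithTop ℕ∞) := by exact_mod_cast le_top
    have h1 : iteratedFDeriv ℝ k (fun p => modeCoeff ω c d i * dirichletMode ω i p) p =
        modeCoeff ω c d i • iteratedFDeriv ℝ k (dirichletMode ω i) p :=
      iteratedFDeriv_const_smul_apply (a := modeCoeff ω c d i)
        ((isWave_dirichletMode ω i).contDiff.of_le hk).contDiffAt
    rw [h1, norm_smul, mul_one]
    refine mul_le_mul (norm_modeCoeff_le hω c d i)
      ((norm_iteratedFDeriv_waveDirichletBasis_le _ _ _ k p).trans ?_) (norm_nonneg _)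
      (by positivity)
    have h : ∀ j, |ω * i.1 j| ≤ ω * ‖i.1‖ := fun j => by
      have := norm_le_pi_norm i.1 j
      rw [Int.norm_eq_abs] at this
      rw [abs_mul, abs_of_pos hω]
      exact mul_le_mul_of_nonneg_left this hω.le
    have h' : |timeFreq ω i| + |ω * i.1 0| + |ω * i.1 1| ≤ 4 * ω * ‖i.1‖ := by
      linarith [h 0, h 1, abs_timeFreq_le hω i]
    exact mul_le_mul_of_nonneg_left (pow_le_pow_left₀ (by positivity) h' k) (by norm_num)

/-- The Fourier exponential of frequency `n` in the space variables. -/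
noncomputable def spaceMode (ω : ℝ) (n : Fin 2 → ℤ) (x y : ℝ) : ℂ :=
  Complex.exp (Complex.I * (ω * (n 0 * x + n 1 * y)))

theorem dirichletMode_zero (ω : ℝ) (i : (Fin 2 → ℤ) × Bool) (x y : ℝ) :
    dirichletMode ω i (0, x, y) = spaceMode ω i.1 x y - spaceMode ω i.1 (-x) y := by
  simp only [dirichletMode, waveDirichletBasis, spaceMode]
  push_cast
  congr 2 <;> ring

theorem dirDeriv_dirichletMode_zero (ω : ℝ) (i : (Fin 2 → ℤ) × Bool) (x y : ℝ) :
    dirDeriv (1, 0, 0) (dirichletMode ω i) (0, x, y) =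
      Complex.I * timeFreq ω i * (spaceMode ω i.1 x y - spaceMode ω i.1 (-x) y) := by
  have h : ∀ ℓ p, DifferentiableAt ℝ (planeWave ℓ) p := fun ℓ p =>
    (contDiff_planeWave ℓ).differentiableAt_of_top p
  rw [← dirichletMode_zero, dirichletMode, waveDirichletBasis_I_mul, dirDeriv_sub _ (h _ _) (h _ _),
    dirDeriv_planeWave, dirDeriv_planeWave]
  simp only [linearPhase_apply]
  push_cast
  ring

theorem timeFreq_false (ω : ℝ) (n : Fin 2 → ℤ) : timeFreq ω (n, false) = -timeFreq ω (n, true) := by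
  simp [timeFreq]

theorem tsum_dirichletMode_zero {ω : ℝ} (hω : 0 < ω) {c d : (Fin 2 → ℤ) → ℂ}
    (hc : ∀ k : ℕ, Summable fun n => ‖n‖ ^ k * ‖c n‖)
    (hd : ∀ k : ℕ, Summable fun n => ‖n‖ ^ k * ‖d n‖) {x y : ℝ} {a b : ℂ}
    (ha : HasSum (fun n => c n * spaceMode ω n x y) a)
    (hb : HasSum (fun n => c n * spaceMode ω n (-x) y) b) :
    ∑' i, modeCoeff ω c d i * dirichletMode ω i (0, x, y) = (a - b) / 2 := by
  rw [((smoothSummable_dirichletMode hω hc hd).summable (0, x, y)).tsum_prod]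
  refine Eq.trans (tsum_congr fun n => ?_) ((ha.sub hb).div_const 2).tsum_eq
  simp only [tsum_bool, dirichletMode_zero, modeCoeff, timeFreq_false]
  push_cast
  rw [mul_neg, mul_neg, div_neg]
  ring

theorem tsum_dirDeriv_dirichletMode_zero {ω : ℝ} (hω : 0 < ω) {c d : (Fin 2 → ℤ) → ℂ}
    (hc : ∀ k : ℕ, Summable fun n => ‖n‖ ^ k * ‖c n‖)
    (hd : ∀ k : ℕ, Summable fun n => ‖n‖ ^ k * ‖d n‖) {x y : ℝ} {a b : ℂ}
    (ha : HasSum (fun n => d n * spaceMode ω n x y) a)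
    (hb : HasSum (fun n => d n * spaceMode ω n (-x) y) b) :
    dirDeriv (1, 0, 0) (fun p => ∑' i, modeCoeff ω c d i * dirichletMode ω i p) (0, x, y) =
      (a - b) / 2 := by
  have hs := smoothSummable_dirichletMode hω hc hd
  rw [hs.dirDeriv_tsum]
  simp only
  rw [((hs.dirDeriv (1, 0, 0)).summable (0, x, y)).tsum_prod]
  refine Eq.trans (tsum_congr fun n => ?_) ((ha.sub hb).div_const 2).tsum_eq
  have hdiff : ∀ i, Differentiable ℝ (dirichletMode ω i) := fun i =>
    (isWave_dirichletMode ω i).contDiff.differentiable (by simp)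
  simp only [tsum_bool, dirDeriv_const_mul (hdiff _), dirDeriv_dirichletMode_zero, modeCoeff,
    timeFreq_false]
  by_cases h : timeFreq ω (n, true) = 0
  · have h2 := sq_timeFreq ω (n, true)
    rw [h] at h2
    have h0 : (n 0 : ℝ) = 0 := by
      have : (ω * n 0) ^ 2 = 0 := by nlinarith [sq_nonneg (ω * n 0), sq_nonneg (ω * n 1)]
      simpa [hω.ne'] using this
    have h0' : (n 0 : ℂ) = 0 := by exact_mod_cast h0
    simp [h, spaceMode, h0']
  · have h' : (timeFreq ω (n, true) : ℂ) ≠ 0 := by exact_mod_cast h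
    push_cast
    have := Complex.I_ne_zero
    field_simp
    ring

end Modes

section Density

open Set Filter Topology

/-- Locally in space-time, a solution of the wave equation that is odd in `x` is a normally
convergent series of Dirichlet modes. -/
theorem IsWave.exists_eq_tsum_dirichletMode {v : ℝ × ℝ × ℝ → ℂ} (hv : IsWave v)
    (hodd : ∀ p, v (reflectX p) = -v p) {S : ℝ} (hS : 0 < S) :
    ∃ C : (Fin 2 → ℤ) × Bool → ℂ,
      SmoothSummable (fun i p => C i * dirichletMode (baseFreq S) i p) ∧
      ∀ p, hyperboloidHeight p + |p.1| < S →
        v p = ∑' i, C i * dirichletMode (baseFreq S) i p := by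
  have hω := baseFreq_pos hS
  have hslice : ∀ {w : ℝ × ℝ × ℝ → ℂ}, ContDiff ℝ (⊤ : ℕ∞) w →
      ContDiff ℝ (⊤ : ℕ∞) fun q : ℝ × ℝ => w (0, q) := fun hw =>
    hw.comp (contDiff_const.prodMk contDiff_id)
  obtain ⟨c, hc, hc'⟩ := exists_fourier_expansion (hslice hv.contDiff) hS
  obtain ⟨d, hd, hd'⟩ := exists_fourier_expansion (hslice (hv.contDiff.dirDeriv (1, 0, 0))) hS
  have hs := smoothSummable_dirichletMode hω hc hd
  have hdiff := hv.contDiff.differentiable (by simp)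
  have hodd' : ∀ p, dirDeriv (1, 0, 0) v (reflectX p) = -dirDeriv (1, 0, 0) v p := by
    intro p
    have h1 := congrFun (dirDeriv_comp_clm reflectX hdiff (1, 0, 0)) p
    have h2 := congrFun (dirDeriv_clm_comp (-ContinuousLinearMap.id ℝ ℂ) hdiff (1, 0, 0)) p
    have h3 : reflectX (1, 0, 0) = (1, 0, 0) := by simp
    simp only [neg_apply, ContinuousLinearMap.id_apply] at h2
    rw [funext hodd, h2, h3] at h1
    exact h1.symm
  have hW : IsWave fun p => ∑' i, modeCoeff (baseFreq S) c d i * dirichletMode (baseFreq S) i p :=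
    IsWave.tsum hs fun i => (isWave_dirichletMode _ i).clm_comp
      (ContinuousLinearMap.mul ℝ ℂ (modeCoeff (baseFreq S) c d i))
  refine ⟨_, hs, fun p hp => sub_eq_zero.1 ?_⟩
  refine (hv.sub hW).eq_zero_of_cauchy hS (fun x y hxy => ?_) (fun x y hxy => ?_) hp
  · have hneg := hodd (0, x, y)
    simp only [reflectX_apply] at hneg
    rw [tsum_dirichletMode_zero hω hc hd (hc' x y hxy) (hc' (-x) y (by rwa [neg_sq])), hneg]
    ring
  · have hneg := hodd' (0, x, y)
    simp only [reflectX_apply] at hneg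
    rw [dirDeriv_sub _ (hdiff _) (hW.contDiff.differentiableAt_of_top _),
      tsum_dirDeriv_dirichletMode_zero hω hc hd (hd' x y hxy) (hd' (-x) y (by rwa [neg_sq])), hneg]
    ring

theorem d1_eq_dirDeriv {w : ℝ × ℝ × ℝ → ℂ} (hw : Differentiable ℝ w) :
    d1 w = dirDeriv (1, 0, 0) w := by
  ext p
  have h : HasDerivAt (fun s : ℝ => (s, p.2.1, p.2.2)) ((1 : ℝ), (0 : ℝ), (0 : ℝ)) p.1 :=
    (hasDerivAt_id _).prodMk (hasDerivAt_const _ _)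
  exact ((hw p).hasFDerivAt.comp_hasDerivAt p.1 h).deriv

theorem d2_eq_dirDeriv {w : ℝ × ℝ × ℝ → ℂ} (hw : Differentiable ℝ w) :
    d2 w = dirDeriv (0, 1, 0) w := by
  ext p
  have h : HasDerivAt (fun s : ℝ => (p.1, s, p.2.2)) ((0 : ℝ), (1 : ℝ), (0 : ℝ)) p.2.1 :=
    (hasDerivAt_const _ _).prodMk ((hasDerivAt_id _).prodMk (hasDerivAt_const _ _))
  exact ((hw p).hasFDerivAt.comp_hasDerivAt p.2.1 h).deriv

theorem d3_eq_dirDeriv {w : ℝ × ℝ × ℝ → ℂ} (hw : Differentiable ℝ w) :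
    d3 w = dirDeriv (0, 0, 1) w := by
  ext p
  have h : HasDerivAt (fun s : ℝ => (p.1, p.2.1, s)) ((0 : ℝ), (0 : ℝ), (1 : ℝ)) p.2.2 :=
    (hasDerivAt_const _ _).prodMk ((hasDerivAt_const _ _).prodMk (hasDerivAt_id _))
  exact ((hw p).hasFDerivAt.comp_hasDerivAt p.2.2 h).deriv

theorem reflectExtend_neg_one_reflectX {u : ℝ × ℝ × ℝ → ℂ} (hbc : ∀ t y : ℝ, u (t, 0, y) = 0)
    (p : ℝ × ℝ × ℝ) : reflectExtend (-1) u (reflectX p) = -reflectExtend (-1) u p := by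
  obtain ⟨t, x, y⟩ := p
  rcases lt_trichotomy x 0 with hx | rfl | hx
  · simp [reflectExtend, hx.not_ge, hx.le]
  · simp [reflectExtend, hbc]
  · simp [reflectExtend, hx.not_ge, hx.le]

/-- A bound on the derivatives in the open half space extends to its boundary. -/
theorem norm_iteratedFDeriv_le_of_pos {h : ℝ × ℝ × ℝ → ℂ} (hh : ContDiff ℝ (⊤ : ℕ∞) h) {k : ℕ}
    {ε : ℝ} {U : Set (ℝ × ℝ × ℝ)} (hU : IsOpen U)
    (hle : ∀ p ∈ U, 0 < p.2.1 → ‖iteratedFDeriv ℝ k h p‖ ≤ ε) {p : ℝ × ℝ × ℝ} (hp : p ∈ U)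
    (hp0 : 0 ≤ p.2.1) : ‖iteratedFDeriv ℝ k h p‖ ≤ ε := by
  have hk : (k : WithTop ℕ∞) ≤ ((⊤ : ℕ∞) : WithTop ℕ∞) := by exact_mod_cast le_top
  have hcont : Continuous fun s : ℝ => (p.1, p.2.1 + s, p.2.2) := by fun_prop
  have hpath : Tendsto (fun s : ℝ => (p.1, p.2.1 + s, p.2.2)) (𝓝[>] 0) (𝓝 p) := by
    have := hcont.tendsto 0
    rw [add_zero] at this
    exact this.mono_left nhdsWithin_le_nhds
  have hlim := ((hh.continuous_iteratedFDeriv hk).norm.tendsto p).comp hpath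
  refine le_of_tendsto hlim ?_
  filter_upwards [hpath.eventually (hU.mem_nhds hp), self_mem_nhdsWithin] with s hs hs0
  exact hle _ hs (add_pos_of_nonneg_of_pos hp0 hs0)

end Density

/-- The B-EPGP basis has dense span in the smooth solutions of the 2D wave equation on the
halfspace `{x ≥ 0}` with Dirichlet boundary condition at `x = 0`. -/
theorem bepgp_wave2D_dirichlet_dense
    (u : ℝ × ℝ × ℝ → ℂ) (hu : ContDiff ℝ (⊤ : ℕ∞) u)
    (hwave : ∀ t x y : ℝ, 0 ≤ x →
      d1 (d1 u) (t, x, y) = d2 (d2 u) (t, x, y) + d3 (d3 u) (t, x, y))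
    (hbc : ∀ t y : ℝ, u (t, 0, y) = 0)
    (K : Set (ℝ × ℝ × ℝ)) (hKc : IsCompact K)
    (hK : K ⊆ Set.univ ×ˢ Set.Ici (0 : ℝ) ×ˢ Set.univ)
    (m : ℕ) (ε : ℝ) (hε : 0 < ε) :
    ∃ (r : ℕ) (a b c : Fin r → ℂ) (c' : Fin r → ℂ),
      (∀ j, a j ^ 2 = b j ^ 2 + c j ^ 2) ∧
      ∀ k ≤ m, ∀ p ∈ K,
        ‖iteratedFDeriv ℝ k
            (fun q => u q - ∑ j, c' j * waveDirichletBasis (a j) (b j) (c j) q) p‖ ≤ ε := by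
  have hd := hu.differentiable (by simp)
  have hdd : ∀ e, Differentiable ℝ (dirDeriv e u) := fun e =>
    (hu.dirDeriv e).differentiable (by simp)
  have hhalf : IsHalfWave (-1) u := by
    refine ⟨hu, fun p hp => ?_, Or.inl ⟨rfl, hbc⟩⟩
    have := hwave p.1 p.2.1 p.2.2 hp
    rwa [d1_eq_dirDeriv hd, d1_eq_dirDeriv (hdd _), d2_eq_dirDeriv hd, d2_eq_dirDeriv (hdd _),
      d3_eq_dirDeriv hd, d3_eq_dirDeriv (hdd _)] at this
  have hcontU : Continuous fun p : ℝ × ℝ × ℝ => hyperboloidHeight p + |p.1| :=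
    continuous_hyperboloidHeight.add continuous_fst.abs
  obtain ⟨B, hB⟩ := hKc.bddAbove_image hcontU.continuousOn
  set S : ℝ := max B 0 + 1 with hSdef
  have hS : 0 < S := by positivity
  have hKS : ∀ p ∈ K, hyperboloidHeight p + |p.1| < S := fun p hp =>
    (hB (Set.mem_image_of_mem _ hp)).trans_lt ((le_max_left B 0).trans_lt (lt_add_one _))
  obtain ⟨C, hC, hCv⟩ := hhalf.isWave_reflectExtend.exists_eq_tsum_dirichletMode
    (reflectExtend_neg_one_reflectX hbc) hS
  obtain ⟨s, hs⟩ := ((Finset.eventually_all (Finset.range (m + 1))).2 fun k _ =>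
    hC.eventually_norm_iteratedFDeriv_tsum_sub_le k hε).exists
  let e := s.equivFin.symm
  refine ⟨s.card, fun j => Complex.I * timeFreq (baseFreq S) (e j),
    fun j => Complex.I * (baseFreq S * (e j).1.1 0 : ℝ),
    fun j => Complex.I * (baseFreq S * (e j).1.1 1 : ℝ), fun j => C (e j), fun j => ?_,
    fun k hk p hp => ?_⟩
  · have : (timeFreq (baseFreq S) (e j) : ℂ) ^ 2 =
        (baseFreq S * (e j).1.1 0 : ℝ) ^ 2 + (baseFreq S * (e j).1.1 1 : ℝ) ^ 2 := by
      exact_mod_cast sq_timeFreq (baseFreq S) (e j)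
    simp only [mul_pow, this]
    ring
  · have hsum : ∀ q, ∑ j, C (e j) * waveDirichletBasis
        (Complex.I * timeFreq (baseFreq S) (e j)) (Complex.I * (baseFreq S * (e j).1.1 0 : ℝ))
        (Complex.I * (baseFreq S * (e j).1.1 1 : ℝ)) q =
        ∑ i ∈ s, C i * dirichletMode (baseFreq S) i q := fun q => by
      rw [← Finset.sum_coe_sort s fun i => C i * dirichletMode (baseFreq S) i q]
      exact e.sum_comp fun i : s => C i * dirichletMode (baseFreq S) i q
    simp only [hsum]
    have hU : IsOpen {q : ℝ × ℝ × ℝ | hyperboloidHeight q + |q.1| < S} :=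
      isOpen_lt hcontU continuous_const
    refine norm_iteratedFDeriv_le_of_pos (hu.sub (ContDiff.sum fun i _ => hC.contDiff i)) hU
      (fun q hq hq0 => ?_) (hKS p hp) (hK hp).2.1
    refine le_trans (le_of_eq (congrArg norm ?_)) (hs k (Finset.mem_range.2 (by lia)) q)
    refine Filter.EventuallyEq.eq_of_nhds (Filter.EventuallyEq.iteratedFDeriv ℝ ?_ k)
    have hpos : IsOpen {q : ℝ × ℝ × ℝ | 0 < q.2.1} := isOpen_lt (by fun_prop) (by fun_prop)
    filter_upwards [hU.mem_nhds hq, hpos.mem_nhds hq0] with z hz hz0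
    rw [← hCv z hz, reflectExtend, if_pos (le_of_lt hz0)]
end
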